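/- For every integer q ≥ 1 there exists a constant α_q > 0 with the following property: if C is a finite set of distinct points on S^q and m is a positive integer with m ≤ α_q (δ_C(S^q))^{−1}, then C admits an M–Z quadrature of order m; moreover the weights (w_ξ)_{ξ∈C} may be chosen so that the number of ξ with w_ξ ≠ 0 is between c m^q and c' m^q for constants c, c' > 0 depending only on q (i.e., comparable to dim Π_{2m}^q). -/

import Mathlib

noncomputable section

open MeasureTheory Finset

namespace SD

/-- Euclidean space `ℝ^(q+1)`. -/
abbrev Euc (q : ℕ) := EuclideanSpace ℝ (Fin (q + 1))

/-- The unit sphere `S^q ⊂ ℝ^(q+1)`, as a type. -/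
abbrev Sph (q : ℕ) : Type := Metric.sphere (0 : Euc q) 1

/-- Dot product of two points of the sphere. -/
def dot {q : ℕ} (x y : Sph q) : ℝ := ∑ i, (x : Euc q) i * (y : Euc q) i

/-- Geodesic distance `arccos (x ⬝ y)` on the sphere. -/
def gdist {q : ℕ} (x y : Sph q) : ℝ := Real.arccos (dot x y)

/-- The mesh norm `δ_C(S^q)` of a finite set of points. -/
def meshNorm {q : ℕ} (C : Finset (Sph q)) : ℝ :=
  ⨆ x : Sph q, sInf ((fun ξ => gdist x ξ) '' (C : Set (Sph q)))

/-- `f : S^q → ℝ` belongs to `Π_n^q` : it is the restriction to the sphere of an algebraic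
polynomial in `q+1` variables of total degree at most `n`. -/
def InPi (q n : ℕ) (f : Sph q → ℝ) : Prop :=
  ∃ P : MvPolynomial (Fin (q + 1)) ℝ, P.totalDegree ≤ n ∧
    ∀ x : Sph q, f x = MvPolynomial.eval (fun i => (x : Euc q) i) P

/-- `f` is a spherical harmonic of degree `ℓ` : the restriction to the sphere of a
homogeneous harmonic polynomial of degree `ℓ`. -/
def IsSphHarm (q ℓ : ℕ) (f : Sph q → ℝ) : Prop :=
  ∃ P : MvPolynomial (Fin (q + 1)) ℝ, P.IsHomogeneous ℓ ∧
    (∑ i : Fin (q + 1), MvPolynomial.pderiv i (MvPolynomial.pderiv i P)) = 0 ∧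
    ∀ x : Sph q, f x = MvPolynomial.eval (fun i => (x : Euc q) i) P

/-- Rotation of a point of the sphere by a linear isometry of the ambient space. -/
def rotate {q : ℕ} (R : Euc q ≃ₗᵢ[ℝ] Euc q) (x : Sph q) : Sph q :=
  ⟨R x, by
    have hx : ‖(x : Euc q)‖ = 1 := mem_sphere_zero_iff_norm.mp x.2
    simp [mem_sphere_zero_iff_norm, hx]⟩

/-- `μ` is invariant under all rotations of the sphere. -/
def RotInvariant (q : ℕ) (μ : Measure (Sph q)) : Prop :=
  ∀ R : Euc q ≃ₗᵢ[ℝ] Euc q, Measure.map (rotate R) μ = μ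

/-- `IterIntBV S f` : `f` is an `S` times iterated integral of a function of bounded
variation (on `[0,∞)`). -/
def IterIntBV : ℕ → (ℝ → ℝ) → Prop
  | 0, f => BoundedVariationOn f (Set.Ici 0)
  | (S + 1), f => ∃ g : ℝ → ℝ, IterIntBV S g ∧ ∀ x : ℝ, 0 ≤ x → f x = f 0 + ∫ t in (0 : ℝ)..x, g t

/-- The standing hypotheses on the filter function `h` : `h = 1` on `[0,1/2]`, `h = 0` on
`(1,∞)`, `h` nonincreasing on `[0,∞)`, and `h` an `S` times iterated integral of a function
of bounded variation. -/
def GoodH (S : ℕ) (h : ℝ → ℝ) : Prop :=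
  (∀ x : ℝ, 0 ≤ x → x ≤ 1 / 2 → h x = 1) ∧
  (∀ x : ℝ, 1 < x → h x = 0) ∧
  (∀ x y : ℝ, 0 ≤ x → x ≤ y → h y ≤ h x) ∧
  IterIntBV S h

/-- `Y ℓ ·` is, for each `ℓ`, an orthonormal basis of the space of degree `ℓ` spherical
harmonics in `L²(μ)`. -/
def GoodBasis (q : ℕ) (μ : Measure (Sph q)) (d : ℕ → ℕ)
    (Y : (ℓ : ℕ) → Fin (d ℓ) → Sph q → ℝ) : Prop :=
  (∀ ℓ k, IsSphHarm q ℓ (Y ℓ k)) ∧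
  (∀ (ℓ ℓ' : ℕ) (k : Fin (d ℓ)) (k' : Fin (d ℓ')),
      ∫ x, Y ℓ k x * Y ℓ' k' x ∂μ = if ℓ = ℓ' ∧ (k : ℕ) = (k' : ℕ) then 1 else 0) ∧
  (∀ (ℓ : ℕ) (f : Sph q → ℝ), IsSphHarm q ℓ f →
      ∃ a : Fin (d ℓ) → ℝ, ∀ x, f x = ∑ k, a k * Y ℓ k x)

/-- The kernel `Φ_n(h; x·ξ) = Σ_{ℓ=0}^n h(ℓ/n) Σ_k Y_{ℓ,k}(x) Y_{ℓ,k}(ξ)`. -/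
def Phi {q : ℕ} (d : ℕ → ℕ) (Y : (ℓ : ℕ) → Fin (d ℓ) → Sph q → ℝ) (h : ℝ → ℝ) (n : ℕ)
    (x ξ : Sph q) : ℝ :=
  ∑ ℓ ∈ range (n + 1), h ((ℓ : ℝ) / (n : ℝ)) * ∑ k, Y ℓ k x * Y ℓ k ξ

/-- The discretized operator `σ_n(C, W; h; Z, x) = Σ_{ξ∈C} w_ξ z_ξ Φ_n(h; x·ξ)`. -/
def sigmaOp {q : ℕ} (d : ℕ → ℕ) (Y : (ℓ : ℕ) → Fin (d ℓ) → Sph q → ℝ) (h : ℝ → ℝ) (n : ℕ)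
    (C : Finset (Sph q)) (w : Sph q → ℝ) (z : Sph q → ℝ) (x : Sph q) : ℝ :=
  ∑ ξ ∈ C, w ξ * z ξ * Phi d Y h n x ξ

/-- The summability operator `σ*_n(h; f, x) = ∫ f(ζ) Φ_n(h; x·ζ) dμ(ζ)`. -/
def sigmaStar {q : ℕ} (μ : Measure (Sph q)) (d : ℕ → ℕ)
    (Y : (ℓ : ℕ) → Fin (d ℓ) → Sph q → ℝ) (h : ℝ → ℝ) (n : ℕ) (f : Sph q → ℝ)
    (x : Sph q) : ℝ :=
  ∫ ζ, f ζ * Phi d Y h n x ζ ∂μ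

/-- Sup norm on the sphere. -/
def supNorm {q : ℕ} (f : Sph q → ℝ) : ℝ := ⨆ x : Sph q, |f x|

/-- Sup norm on a subset of the sphere. -/
def supNormOn {q : ℕ} (K : Set (Sph q)) (f : Sph q → ℝ) : ℝ := ⨆ x ∈ K, |f x|

/-- The spherical cap of radius `δ` centered at `x₀`. -/
def cap {q : ℕ} (x₀ : Sph q) (δ : ℝ) : Set (Sph q) := {x | gdist x x₀ ≤ δ}

/-- `C` admits a Marcinkiewicz–Zygmund quadrature of order `m` with weights `w` and
M–Z constant `c₀`. -/
def MZQuad (q : ℕ) (μ : Measure (Sph q)) (m : ℕ) (C : Finset (Sph q)) (w : Sph q → ℝ)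
    (c₀ : ℝ) : Prop :=
  (∀ P : Sph q → ℝ, InPi q (2 * m) P → ∑ ξ ∈ C, w ξ * P ξ = ∫ x, P x ∂μ) ∧
  (∀ P : Sph q → ℝ, InPi q (2 * m) P → ∀ p : ℝ, 1 ≤ p →
      (∑ ξ ∈ C, |w ξ| * |P ξ| ^ p) ^ (1 / p) ≤ c₀ * (∫ x, |P x| ^ p ∂μ) ^ (1 / p))

/-- The sequence `n ↦ 2^((n+1)r) ‖σ*_{2^(n+1)}(h;f) − σ*_{2^n}(h;f)‖_{∞,K}`. -/
def WrSeqOn {q : ℕ} (K : Set (Sph q)) (μ : Measure (Sph q)) (d : ℕ → ℕ)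
    (Y : (ℓ : ℕ) → Fin (d ℓ) → Sph q → ℝ) (h : ℝ → ℝ) (r : ℝ) (f : Sph q → ℝ) (n : ℕ) : ℝ :=
  (2 : ℝ) ^ (((n : ℝ) + 1) * r) *
    supNormOn K (fun x => sigmaStar μ d Y h (2 ^ (n + 1)) f x - sigmaStar μ d Y h (2 ^ n) f x)

/-- The norm `‖f‖_{W_r(K)}`. -/
def WrNormOn {q : ℕ} (K : Set (Sph q)) (μ : Measure (Sph q)) (d : ℕ → ℕ)
    (Y : (ℓ : ℕ) → Fin (d ℓ) → Sph q → ℝ) (h : ℝ → ℝ) (r : ℝ) (f : Sph q → ℝ) : ℝ :=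
  supNorm f + ⨆ n : ℕ, WrSeqOn K μ d Y h r f n

/-- The norm `‖f‖_{W_r}`. -/
def WrNorm {q : ℕ} (μ : Measure (Sph q)) (d : ℕ → ℕ)
    (Y : (ℓ : ℕ) → Fin (d ℓ) → Sph q → ℝ) (h : ℝ → ℝ) (r : ℝ) (f : Sph q → ℝ) : ℝ :=
  WrNormOn Set.univ μ d Y h r f

/-- Membership in `W_r(K)` : `f` is continuous and the `W_r(K)` seminorm is finite. -/
def MemWrOn {q : ℕ} (K : Set (Sph q)) (μ : Measure (Sph q)) (d : ℕ → ℕ)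
    (Y : (ℓ : ℕ) → Fin (d ℓ) → Sph q → ℝ) (h : ℝ → ℝ) (r : ℝ) (f : Sph q → ℝ) : Prop :=
  Continuous f ∧ BddAbove (Set.range (WrSeqOn K μ d Y h r f))

/-- `y` is an orthonormal basis of `Π_n^q` in `L²(μ)` (so `N = dim Π_n^q`), whose `0`-th
element is the constant polynomial `1`. -/
def GoodPolyBasis (q n N : ℕ) (μ : Measure (Sph q)) (y : Fin N → Sph q → ℝ) : Prop :=
  (∀ i, InPi q n (y i)) ∧
  (∀ i j, ∫ x, y i x * y j x ∂μ = if i = j then 1 else 0) ∧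
  (∀ P : Sph q → ℝ, InPi q n P → ∃ a : Fin N → ℝ, ∀ x, P x = ∑ i, a i * y i x) ∧
  (∀ i : Fin N, (i : ℕ) = 0 → ∀ x, y i x = 1)

/-- The Gram matrix `(G_N)_{i,j} = Σ_{ξ∈C} v_ξ y_i(ξ) y_j(ξ)`. -/
def gram {q N : ℕ} (C : Finset (Sph q)) (v : Sph q → ℝ) (y : Fin N → Sph q → ℝ) :
    Matrix (Fin N) (Fin N) ℝ :=
  Matrix.of fun i j => ∑ ξ ∈ C, v ξ * y i ξ * y j ξ

/-- The least squares quadrature weights `w_ξ^{LSQ} = v_ξ Σ_k (G_N⁻¹)_{i₀,k} y_k(ξ)`. -/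
def wLSQ {q N : ℕ} (C : Finset (Sph q)) (v : Sph q → ℝ) (y : Fin N → Sph q → ℝ) (i0 : Fin N)
    (ξ : Sph q) : ℝ :=
  v ξ * ∑ k, (gram C v y)⁻¹ i0 k * y k ξ

/-- Two–sided Marcinkiewicz–Zygmund inequalities for the masses `v` on `C`, for all
`1 ≤ p ≤ ∞`. -/
def VMZ (q n : ℕ) (μ : Measure (Sph q)) (C : Finset (Sph q)) (v : Sph q → ℝ)
    (c₁ c₂ : ℝ) : Prop :=
  (∀ P : Sph q → ℝ, InPi q n P → ∀ p : ℝ, 1 ≤ p →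
      c₁ * (∫ x, |P x| ^ p ∂μ) ^ (1 / p) ≤ (∑ ξ ∈ C, v ξ * |P ξ| ^ p) ^ (1 / p) ∧
      (∑ ξ ∈ C, v ξ * |P ξ| ^ p) ^ (1 / p) ≤ c₂ * (∫ x, |P x| ^ p ∂μ) ^ (1 / p)) ∧
  (∀ P : Sph q → ℝ, InPi q n P →
      c₁ * supNorm P ≤ (⨆ ξ ∈ (C : Set (Sph q)), |P ξ|) ∧
      (⨆ ξ ∈ (C : Set (Sph q)), |P ξ|) ≤ c₂ * supNorm P)


/-- The complex trigonometric polynomials of degree at most `n`. -/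
def trigPoly (n : ℕ) : Submodule ℂ (ℝ → ℂ) :=
  Submodule.span ℂ ((fun (k : ℤ) (s : ℝ) => Complex.exp (k * s * Complex.I)) '' {k | |k| ≤ n})

theorem exp_mem_trigPoly {n : ℕ} {k : ℤ} (hk : |k| ≤ n) :
    (fun s : ℝ => Complex.exp (k * s * Complex.I)) ∈ trigPoly n :=
  Submodule.subset_span ⟨k, hk, rfl⟩

theorem trigPoly_mono {a b : ℕ} (h : a ≤ b) : trigPoly a ≤ trigPoly b := by
  refine Submodule.span_mono (Set.image_mono fun k (hk : |k| ≤ a) => ?_)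
  exact hk.trans (by exact_mod_cast h)

theorem const_mem_trigPoly (n : ℕ) (z : ℂ) : (fun _ : ℝ => z) ∈ trigPoly n := by
  have h := (trigPoly n).smul_mem z (exp_mem_trigPoly (n := n) (k := 0) (by simp))
  convert h using 1
  ext s
  simp

theorem mul_mem_trigPoly {a b : ℕ} {f g : ℝ → ℂ} (hf : f ∈ trigPoly a) (hg : g ∈ trigPoly b) :
    f * g ∈ trigPoly (a + b) := by
  have h : trigPoly a * trigPoly b ≤ trigPoly (a + b) := by
    rw [trigPoly, trigPoly, Submodule.span_mul_span, Submodule.span_le]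
    rintro _ ⟨_, ⟨k, hk, rfl⟩, _, ⟨l, hl, rfl⟩, rfl⟩
    simp only [Set.mem_ofPred_eq] at hk hl
    have := exp_mem_trigPoly (n := a + b) (k := k + l)
      ((abs_add_le k l).trans (by push_cast; exact add_le_add hk hl))
    refine Set.mem_of_eq_of_mem ?_ this
    ext s
    simp only [Pi.mul_apply, ← Complex.exp_add]
    push_cast
    ring_nf
  exact h (Submodule.mul_mem_mul hf hg)

theorem pow_mem_trigPoly {f : ℝ → ℂ} (hf : f ∈ trigPoly 1) (n : ℕ) : f ^ n ∈ trigPoly n := by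
  induction n with
  | zero => simpa using! const_mem_trigPoly 0 1
  | succ n ih => rw [pow_succ]; exact mul_mem_trigPoly ih hf

theorem prod_mem_trigPoly {ι : Type*} (s : Finset ι) {f : ι → ℝ → ℂ} {d : ι → ℕ}
    (hf : ∀ i ∈ s, f i ∈ trigPoly (d i)) : ∏ i ∈ s, f i ∈ trigPoly (∑ i ∈ s, d i) := by
  classical
  induction s using Finset.induction_on with
  | empty => simpa using! const_mem_trigPoly 0 1
  | insert a s ha ih =>
    rw [prod_insert ha, sum_insert ha]
    exact mul_mem_trigPoly (hf a (mem_insert_self a s))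
      (ih fun i hi => hf i (mem_insert_of_mem hi))

theorem cos_mem_trigPoly : (fun s : ℝ => (Real.cos s : ℂ)) ∈ trigPoly 1 := by
  have h := (trigPoly 1).smul_mem (1 / 2 : ℂ) ((trigPoly 1).add_mem
    (exp_mem_trigPoly (n := 1) (k := 1) (by simp)) (exp_mem_trigPoly (n := 1) (k := -1) (by simp)))
  convert h using 1
  ext s
  simp [Complex.cos]
  ring

theorem sin_mem_trigPoly : (fun s : ℝ => (Real.sin s : ℂ)) ∈ trigPoly 1 := by
  have h := (trigPoly 1).smul_mem (Complex.I / 2) ((trigPoly 1).sub_mem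
    (exp_mem_trigPoly (n := 1) (k := -1) (by simp)) (exp_mem_trigPoly (n := 1) (k := 1) (by simp)))
  convert h using 1
  ext s
  simp [Complex.sin]
  ring

/-- A polynomial of total degree `n` evaluated along a curve whose coordinates are trigonometric
polynomials of degree one is a trigonometric polynomial of degree `n`. -/
theorem eval_mem_trigPoly {ι : Type*} [Fintype ι] {n : ℕ} {P : MvPolynomial ι ℝ}
    (hP : P.totalDegree ≤ n) {γ : ℝ → ι → ℝ}
    (hγ : ∀ i, (fun s => (γ s i : ℂ)) ∈ trigPoly 1) :
    (fun s => (MvPolynomial.eval (γ s) P : ℂ)) ∈ trigPoly n := by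
  have h : (fun s => (MvPolynomial.eval (γ s) P : ℂ)) =
      ∑ d ∈ P.support, ((P.coeff d : ℝ) : ℂ) • ∏ i, (fun s => (γ s i : ℂ)) ^ d i := by
    ext s
    simp [MvPolynomial.eval_eq', Finset.sum_apply]
  rw [h]
  refine Submodule.sum_mem _ fun d hd => Submodule.smul_mem _ _ ?_
  refine trigPoly_mono ?_ (prod_mem_trigPoly univ fun i _ => pow_mem_trigPoly (hγ i) (d i))
  refine le_trans (le_of_eq ?_) ((MvPolynomial.le_totalDegree hd).trans hP)
  simp [Finsupp.sum_fintype]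

/-- Orthogonality of characters on the equispaced grid with `N` points. -/
theorem sum_exp_grid {N : ℕ} {d : ℤ} (hd : |d| < N) :
    ∑ l ∈ range N, Complex.exp (d * (2 * Real.pi * l / N : ℝ) * Complex.I) =
      if d = 0 then (N : ℂ) else 0 := by
  split_ifs with h
  · simp [h]
  have hN : 0 < N := by
    rcases Nat.eq_zero_or_pos N with rfl | h
    · have := abs_nonneg d
      norm_num at hd
      omega
    · exact h
  have hN' : (N : ℂ) ≠ 0 := by exact_mod_cast hN.ne'
  set z : ℂ := Complex.exp (d * (2 * Real.pi / N) * Complex.I) with hz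
  have hpow : ∀ l : ℕ, Complex.exp (d * (2 * Real.pi * l / N : ℝ) * Complex.I) = z ^ l := by
    intro l
    rw [hz, ← Complex.exp_nat_mul]
    congr 1
    push_cast
    ring
  simp_rw [hpow]
  have hz1 : z ≠ 1 := by
    intro h1
    obtain ⟨k, hk⟩ := Complex.exp_eq_one_iff.1 h1
    have h2 : (d : ℂ) = k * N := by
      have : (2 * Real.pi * Complex.I : ℂ) ≠ 0 := Complex.two_pi_I_ne_zero
      field_simp at hk
      have h3 : (2 * Real.pi * Complex.I : ℂ) * d = (2 * Real.pi * Complex.I) * (k * N) := by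
        linear_combination (2 * Real.pi * Complex.I) * hk
      exact mul_left_cancel₀ this h3
    have h3 : d = k * N := by exact_mod_cast h2
    have h4 : k = 0 := by
      by_contra hk0
      have : 1 ≤ |k| := Int.one_le_abs hk0
      rw [h3, abs_mul, Nat.abs_cast] at hd
      nlinarith
    exact h (by simp [h3, h4])
  have hzN : z ^ N = 1 := by
    rw [hz, ← Complex.exp_nat_mul, Complex.exp_eq_one_iff]
    exact ⟨d, by field_simp⟩
  rw [geom_sum_eq hz1, hzN]
  simp

theorem card_filter_sub_eq (n : ℕ) (d : ℤ) :
    #{p ∈ range n ×ˢ range n | (d + p.1 - p.2 : ℤ) = 0} = n - d.natAbs := by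
  rcases le_total 0 d with h | h
  · lift d to ℕ using h
    rw [← card_range (n - (d : ℤ).natAbs)]
    refine card_nbij' (fun p => p.1) (fun a => (a, a + d)) ?_ ?_ ?_ ?_
    · rintro ⟨a, b⟩ hp
      simp at hp ⊢
      omega
    · intro a ha
      simp at ha ⊢
      omega
    · rintro ⟨a, b⟩ hp
      simp at hp ⊢
      omega
    · intro a _
      rfl
  · obtain ⟨e, rfl⟩ : ∃ e : ℕ, d = -e := ⟨d.natAbs, by omega⟩
    rw [← card_range (n - (-(e : ℤ)).natAbs)]
    refine card_nbij' (fun p => p.2) (fun b => (b + e, b)) ?_ ?_ ?_ ?_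
    · rintro ⟨a, b⟩ hp
      simp at hp ⊢
      omega
    · intro a ha
      simp at ha ⊢
      omega
    · rintro ⟨a, b⟩ hp
      simp at hp ⊢
      omega
    · intro a _
      rfl

/-- The unnormalised Fejér kernel as a double exponential sum. -/
theorem normSq_sum_exp (n : ℕ) (s : ℝ) :
    ((Complex.normSq (∑ a ∈ range n, Complex.exp (a * s * Complex.I)) : ℝ) : ℂ) =
      ∑ p ∈ range n ×ˢ range n, Complex.exp (((p.1 : ℤ) - (p.2 : ℤ) : ℤ) * s * Complex.I) := by
  rw [← Complex.mul_conj, map_sum, sum_mul_sum, ← sum_product']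
  refine sum_congr rfl fun p _ => ?_
  rw [← Complex.exp_conj, ← Complex.exp_add]
  simp only [map_mul, Complex.conj_ofReal, Complex.conj_I, map_natCast]
  push_cast
  ring_nf

/-- Averaging the unnormalised Fejér kernel against a character over an equispaced grid. -/
theorem sum_normSq_mul_exp {n N : ℕ} {d : ℤ} (hd : |d| + n ≤ N) :
    ∑ l ∈ range N, ((Complex.normSq (∑ a ∈ range n,
        Complex.exp (a * (2 * Real.pi * l / N : ℝ) * Complex.I)) : ℝ) : ℂ) *
          Complex.exp (d * (2 * Real.pi * l / N : ℝ) * Complex.I) =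
      N * ((n - d.natAbs : ℕ) : ℂ) := by
  simp_rw [normSq_sum_exp, sum_mul, ← Complex.exp_add]
  rw [sum_comm, ← card_filter_sub_eq n d, card_filter, Nat.cast_sum, mul_sum]
  refine sum_congr rfl fun p hp => ?_
  simp only [mem_product, mem_range] at hp
  have hlt : |d + p.1 - p.2| < (N : ℤ) := by
    rw [abs_lt]
    have := abs_le.1 (le_refl |d|)
    omega
  have := sum_exp_grid hlt
  convert this using 1
  · refine sum_congr rfl fun l _ => ?_
    push_cast
    ring_nf
  · push_cast
    simp

/-- The Bernstein weights: a signed measure on an equispaced grid, of total mass at most `2 n`,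
that computes the derivative at `0` of trigonometric polynomials of degree `n`. -/
theorem exists_deriv_weights {n : ℕ} (hn : 1 ≤ n) :
    ∃ (N : ℕ) (c s : ℕ → ℝ), ∑ l ∈ range N, |c l| ≤ 2 * n ∧
      ∀ T ∈ trigPoly n, HasDerivAt T (∑ l ∈ range N, (c l : ℂ) * T (s l)) 0 := by
  set N : ℕ := 3 * n with hNdef
  have hN : (0 : ℝ) < N := by positivity
  have hNC : (N : ℂ) ≠ 0 := by exact_mod_cast hN.ne'
  set s : ℕ → ℝ := fun l => 2 * Real.pi * l / N with hs
  set F : ℕ → ℝ := fun l =>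
    Complex.normSq (∑ a ∈ range n, Complex.exp (a * (s l) * Complex.I)) with hF
  have hF0 : ∀ l, 0 ≤ F l := fun l => Complex.normSq_nonneg _
  have hFsum : ∀ d : ℤ, |d| + n ≤ N →
      ∑ l ∈ range N, (F l : ℂ) * Complex.exp (d * s l * Complex.I) =
        N * ((n - d.natAbs : ℕ) : ℂ) := fun d hd => sum_normSq_mul_exp hd
  refine ⟨N, fun l => 2 / N * (Real.sin (n * s l) * F l), s, ?_, ?_⟩
  · have h0 : ∑ l ∈ range N, F l = N * n := by
      have := hFsum 0 (by simp [hNdef]; omega)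
      simp only [Int.cast_zero, zero_mul, Complex.exp_zero, mul_one, Int.natAbs_zero,
        Nat.sub_zero] at this
      exact_mod_cast this
    calc ∑ l ∈ range N, |2 / N * (Real.sin (n * s l) * F l)|
        ≤ ∑ l ∈ range N, 2 / N * F l := by
          refine sum_le_sum fun l _ => ?_
          rw [abs_mul, abs_mul, abs_of_nonneg (hF0 l), abs_of_nonneg (by positivity)]
          gcongr
          exact mul_le_of_le_one_left (hF0 l) (Real.abs_sin_le_one _)
      _ = 2 * n := by
          rw [← mul_sum, h0]
          field_simp
  · intro T hT
    induction hT using Submodule.span_induction with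
    | mem T hT =>
      obtain ⟨k, hk, rfl⟩ := hT
      have hk' : |k| ≤ (n : ℤ) := hk
      have hderiv : HasDerivAt (fun t : ℝ => Complex.exp (k * t * Complex.I))
          (k * Complex.I) 0 := by
        have h1 : HasDerivAt (fun t : ℝ => (k * t * Complex.I : ℂ)) (k * 1 * Complex.I) 0 :=
          ((Complex.ofRealCLM.hasDerivAt (x := (0 : ℝ))).const_mul (k : ℂ)).mul_const _
        convert h1.cexp using 1
        simp
      convert hderiv using 1
      have hterm : ∀ l, ((2 / N * (Real.sin (n * s l) * F l) : ℝ) : ℂ) *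
          Complex.exp (k * s l * Complex.I) = (1 / (N * Complex.I)) *
            ((F l : ℂ) * Complex.exp ((k + n : ℤ) * s l * Complex.I) -
              (F l : ℂ) * Complex.exp ((k - n : ℤ) * s l * Complex.I)) := by
        intro l
        have e1 : Complex.exp ((k + n : ℤ) * s l * Complex.I) =
            Complex.exp (k * s l * Complex.I) * Complex.exp (n * s l * Complex.I) := by
          rw [← Complex.exp_add]
          push_cast
          ring_nf
        have e2 : Complex.exp ((k - n : ℤ) * s l * Complex.I) =
            Complex.exp (k * s l * Complex.I) * Complex.exp (-(n * s l) * Complex.I) := by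
          rw [← Complex.exp_add]
          push_cast
          ring_nf
        rw [e1, e2]
        push_cast
        rw [Complex.sin]
        field_simp
        linear_combination
          (F l * (Complex.exp (-(n * s l * Complex.I)) - Complex.exp (n * s l * Complex.I))) *
            Complex.I_sq
      simp only [hterm]
      rw [← mul_sum, sum_sub_distrib, hFsum, hFsum]
      · have hcount : ((n - (k + n).natAbs : ℕ) : ℤ) - ((n - (k - n).natAbs : ℕ) : ℤ) = -k := by
          have := abs_le.1 hk'
          omega
        have hcount' : ((n - (k + n).natAbs : ℕ) : ℂ) - ((n - (k - n).natAbs : ℕ) : ℂ) = -k := by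
          exact_mod_cast hcount
        rw [← mul_sub, hcount']
        field_simp
        linear_combination (-k : ℂ) * Complex.I_sq
      · have := abs_le.1 hk'
        have : |k - n| ≤ 2 * (n : ℤ) := abs_le.2 (by omega)
        omega
      · have := abs_le.1 hk'
        have : |k + n| ≤ 2 * (n : ℤ) := abs_le.2 (by omega)
        omega
    | zero => simp
    | add f g _ _ hf hg =>
      refine (hf.add hg).congr_deriv ?_
      simp [mul_add, sum_add_distrib]
    | smul a f _ hf =>
      refine (hf.const_smul a).congr_deriv ?_
      simp only [Pi.smul_apply, smul_eq_mul, mul_sum]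
      exact sum_congr rfl fun l _ => by ring

/-- The evaluation of a polynomial at the points of Euclidean space. -/
def polyFun {q : ℕ} (P : MvPolynomial (Fin (q + 1)) ℝ) (z : Euc q) : ℝ :=
  MvPolynomial.eval (fun i => z i) P

theorem contDiff_polyFun {q : ℕ} (P : MvPolynomial (Fin (q + 1)) ℝ) :
    ContDiff ℝ 1 (polyFun P) := by
  have : polyFun P = fun z : Euc q => ∑ d ∈ P.support, P.coeff d * ∏ i, z i ^ d i := by
    ext z
    exact MvPolynomial.eval_eq' _ _
  rw [this]
  fun_prop

/-- The rotation by the angle `s` in the coordinate plane `(i, j)`, as a linear map. -/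
def planeRotLin {q : ℕ} (i j : Fin (q + 1)) (s : ℝ) : Euc q →ₗ[ℝ] Euc q where
  toFun z := z + ((Real.cos s - 1) * z i + Real.sin s * z j) • EuclideanSpace.single i (1 : ℝ) +
    ((Real.cos s - 1) * z j - Real.sin s * z i) • EuclideanSpace.single j (1 : ℝ)
  map_add' x y := by
    simp only [PiLp.add_apply]
    module
  map_smul' a x := by
    simp only [PiLp.smul_apply, smul_eq_mul, RingHom.id_apply]
    module

theorem planeRotLin_apply {q : ℕ} (i j : Fin (q + 1)) (s : ℝ) (z : Euc q) :
    planeRotLin i j s z =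
      z + ((Real.cos s - 1) * z i + Real.sin s * z j) • EuclideanSpace.single i (1 : ℝ) +
        ((Real.cos s - 1) * z j - Real.sin s * z i) • EuclideanSpace.single j (1 : ℝ) :=
  rfl

theorem norm_planeRotLin {q : ℕ} {i j : Fin (q + 1)} (hij : i ≠ j) (s : ℝ) (z : Euc q) :
    ‖planeRotLin i j s z‖ = ‖z‖ := by
  rw [← sq_eq_sq₀ (norm_nonneg _) (norm_nonneg _), planeRotLin_apply]
  set a := (Real.cos s - 1) * z i + Real.sin s * z j with ha
  set b := (Real.cos s - 1) * z j - Real.sin s * z i with hb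
  rw [add_assoc, norm_add_sq_real, norm_add_sq_real]
  simp only [inner_add_right, inner_smul_right, inner_smul_left, norm_smul,
    EuclideanSpace.inner_single_right, PiLp.norm_single]
  simp [hij.symm]
  rw [ha, hb]
  linear_combination (z i ^ 2 + z j ^ 2) * Real.sin_sq_add_cos_sq s

/-- The rotation by the angle `s` in the coordinate plane `(i, j)`. -/
def planeRot {q : ℕ} {i j : Fin (q + 1)} (hij : i ≠ j) (s : ℝ) : Euc q ≃ₗᵢ[ℝ] Euc q :=
  LinearIsometry.toLinearIsometryEquiv ⟨planeRotLin i j s, norm_planeRotLin hij s⟩ rfl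

theorem planeRot_apply {q : ℕ} {i j : Fin (q + 1)} (hij : i ≠ j) (s : ℝ) (z : Euc q) :
    planeRot hij s z =
      z + ((Real.cos s - 1) * z i + Real.sin s * z j) • EuclideanSpace.single i (1 : ℝ) +
        ((Real.cos s - 1) * z j - Real.sin s * z i) • EuclideanSpace.single j (1 : ℝ) :=
  rfl

/-- The velocity at time `0` of the rotation in the coordinate plane `(i, j)`. -/
def planeGen {q : ℕ} (i j : Fin (q + 1)) (z : Euc q) : Euc q :=
  z j • EuclideanSpace.single i (1 : ℝ) - z i • EuclideanSpace.single j (1 : ℝ)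

theorem hasDerivAt_planeRot {q : ℕ} {i j : Fin (q + 1)} (hij : i ≠ j) (z : Euc q) :
    HasDerivAt (fun s => planeRot hij s z) (planeGen i j z) 0 := by
  simp only [planeRot_apply]
  have hc : HasDerivAt (fun s : ℝ => Real.cos s - 1) 0 0 := by
    simpa using (Real.hasDerivAt_cos 0).sub_const 1
  have hs : HasDerivAt Real.sin 1 0 := by simpa using Real.hasDerivAt_sin 0
  have h1 := ((hc.mul_const (z i)).add (hs.mul_const (z j))).smul_const
    (EuclideanSpace.single i (1 : ℝ) : Euc q)
  have h2 := ((hc.mul_const (z j)).sub (hs.mul_const (z i))).smul_const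
    (EuclideanSpace.single j (1 : ℝ) : Euc q)
  refine ((h1.const_add z).add h2).congr_deriv ?_
  simp [planeGen, sub_eq_add_neg]

theorem eq_sum_planeGen {q : ℕ} {z v : Euc q} (hz : ‖z‖ = 1) (hv : inner ℝ v z = 0) :
    v = ∑ i, ∑ j, (v i * z j) • planeGen i j z := by
  have hz' : ∑ j, z j * z j = 1 := by
    have := real_inner_self_eq_norm_sq z
    rw [hz, PiLp.inner_apply] at this
    simpa [sq] using this
  have hv' : ∑ j, v j * z j = 0 := by
    rw [PiLp.inner_apply] at hv
    simpa [mul_comm] using hv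
  ext k
  simp only [planeGen, smul_sub, smul_smul, sum_sub_distrib, PiLp.sub_apply, WithLp.ofLp_sum,
    Finset.sum_apply, PiLp.smul_apply, PiLp.single_apply, smul_eq_mul]
  simp only [mul_ite, mul_one, mul_zero, sum_ite_eq, mem_univ, if_true]
  rw [sum_comm]
  simp only [sum_ite_eq, mem_univ, if_true]
  have e1 : ∑ j, v k * z j * z j = v k := by
    simp_rw [mul_assoc, ← mul_sum, hz', mul_one]
  have e2 : ∑ j, v j * z k * z j = 0 := by
    calc ∑ j, v j * z k * z j = z k * ∑ j, v j * z j := by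
          rw [mul_sum]
          exact sum_congr rfl fun j _ => by ring
      _ = 0 := by rw [hv', mul_zero]
  rw [e1, e2, sub_zero]

/-- The derivative of a polynomial along an infinitesimal rotation, in terms of values at
rotated points. -/
theorem fderiv_planeGen {q n : ℕ} {N : ℕ} {c s : ℕ → ℝ}
    (hT : ∀ T ∈ trigPoly n, HasDerivAt T (∑ l ∈ range N, (c l : ℂ) * T (s l)) 0)
    {P : MvPolynomial (Fin (q + 1)) ℝ} (hP : P.totalDegree ≤ n) {i j : Fin (q + 1)} (hij : i ≠ j)
    (z : Euc q) :
    fderiv ℝ (polyFun P) z (planeGen i j z) =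
      ∑ l ∈ range N, c l * polyFun P (planeRot hij (s l) z) := by
  have h0 : planeRot hij 0 z = z := by simp [planeRot_apply]
  have hd : HasDerivAt (fun s => polyFun P (planeRot hij s z))
      (fderiv ℝ (polyFun P) z (planeGen i j z)) 0 := by
    have h1 : HasFDerivAt (polyFun P) (fderiv ℝ (polyFun P) z) (planeRot hij 0 z) := by
      rw [h0]
      exact ((contDiff_polyFun P).differentiable one_ne_zero z).hasFDerivAt
    exact h1.comp_hasDerivAt (0 : ℝ) (hasDerivAt_planeRot hij z)
  have hmem : (fun s => (polyFun P (planeRot hij s z) : ℂ)) ∈ trigPoly n := by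
    refine eval_mem_trigPoly (γ := fun s k => planeRot hij s z k) hP fun k => ?_
    have hc := cos_mem_trigPoly
    have hs := sin_mem_trigPoly
    have h1 := const_mem_trigPoly 1
    have hi := (trigPoly 1).add_mem ((trigPoly 1).smul_mem (z i : ℂ) ((trigPoly 1).sub_mem hc (h1 1)))
      ((trigPoly 1).smul_mem (z j : ℂ) hs)
    have hj := (trigPoly 1).sub_mem ((trigPoly 1).smul_mem (z j : ℂ) ((trigPoly 1).sub_mem hc (h1 1)))
      ((trigPoly 1).smul_mem (z i : ℂ) hs)
    have := (trigPoly 1).add_mem ((trigPoly 1).add_mem (h1 (z k))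
      ((trigPoly 1).smul_mem (EuclideanSpace.single i (1 : ℝ) k : ℂ) hi))
      ((trigPoly 1).smul_mem (EuclideanSpace.single j (1 : ℝ) k : ℂ) hj)
    refine Set.mem_of_eq_of_mem ?_ this
    ext s
    simp only [planeRot_apply, PiLp.add_apply, PiLp.smul_apply, smul_eq_mul, Pi.add_apply,
      Pi.smul_apply, Pi.sub_apply]
    push_cast
    ring
  have h2 := (hT _ hmem).unique hd.ofReal_comp
  exact_mod_cast h2.symm

/-- A Bernstein inequality on the sphere: the tangential derivative of a polynomial of degree `n`
is dominated by an average, independent of the polynomial, of its values at rotated points. -/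
theorem exists_bernstein (q : ℕ) {n : ℕ} (hn : 1 ≤ n) :
    ∃ (N : ℕ) (b : Fin N → ℝ) (g : Fin N → Euc q ≃ₗᵢ[ℝ] Euc q),
      (∀ w, 0 ≤ b w) ∧ ∑ w, b w ≤ (q + 1) ^ 2 * (2 * n) ∧
      ∀ P : MvPolynomial (Fin (q + 1)) ℝ, P.totalDegree ≤ n → ∀ z v : Euc q, ‖z‖ = 1 →
        inner ℝ v z = 0 →
          |fderiv ℝ (polyFun P) z v| ≤ ‖v‖ * ∑ w, b w * |polyFun P (g w z)| := by
  classical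
  obtain ⟨N, c, s, hc, hT⟩ := exists_deriv_weights hn
  let ι := (Fin (q + 1) × Fin (q + 1)) × Fin N
  let e : ι ≃ Fin (Fintype.card ι) := Fintype.equivFin ι
  let b : ι → ℝ := fun w => |c w.2|
  let g : ι → Euc q ≃ₗᵢ[ℝ] Euc q := fun w =>
    if h : w.1.1 ≠ w.1.2 then planeRot h (s w.2) else LinearIsometryEquiv.refl ℝ _
  refine ⟨Fintype.card ι, fun k => b (e.symm k), fun k => g (e.symm k), fun k => abs_nonneg _,
    ?_, ?_⟩
  · rw [e.symm.sum_comp b, Fintype.sum_prod_type]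
    simp only [b]
    rw [Finset.sum_const, ← Finset.sum_range (fun l => |c l|)]
    simp only [card_univ, Fintype.card_prod, Fintype.card_fin, nsmul_eq_mul]
    push_cast
    rw [← sq]
    gcongr
  · intro P hP z v hz hv
    rw [e.symm.sum_comp (fun w => b w * |polyFun P (g w z)|), Fintype.sum_prod_type,
      Fintype.sum_prod_type]
    have habs : ∀ (x : Euc q) (i : Fin (q + 1)), |x i| ≤ ‖x‖ := fun x i => by
      simpa using PiLp.norm_apply_le x i
    conv_lhs => rw [eq_sum_planeGen hz hv]
    simp only [map_sum, map_smul, smul_eq_mul, mul_sum]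
    refine (abs_sum_le_sum_abs _ _).trans (sum_le_sum fun i _ => ?_)
    refine (abs_sum_le_sum_abs _ _).trans (sum_le_sum fun j _ => ?_)
    rw [abs_mul, abs_mul, ← mul_sum]
    have h1 : |v i| * |z j| ≤ ‖v‖ := by
      calc |v i| * |z j| ≤ ‖v‖ * 1 :=
            mul_le_mul (habs v i) ((habs z j).trans hz.le) (abs_nonneg _) (norm_nonneg _)
        _ = ‖v‖ := mul_one _
    refine mul_le_mul h1 ?_ (abs_nonneg _) (norm_nonneg _)
    by_cases hij : i = j
    · subst hij
      simp only [planeGen, sub_self, map_zero, abs_zero]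
      exact sum_nonneg fun l _ => mul_nonneg (abs_nonneg _) (abs_nonneg _)
    · rw [fderiv_planeGen hT hP hij, Finset.sum_range]
      refine (abs_sum_le_sum_abs _ _).trans (sum_le_sum fun l _ => ?_)
      simp [b, g, hij, abs_mul]

theorem norm_coe_sph {q : ℕ} (x : Sph q) : ‖(x : Euc q)‖ = 1 :=
  mem_sphere_zero_iff_norm.mp x.2

theorem dot_eq_inner {q : ℕ} (x y : Sph q) : dot x y = inner ℝ (x : Euc q) (y : Euc q) := by
  simp [dot, PiLp.inner_apply, mul_comm]

theorem abs_dot_le_one {q : ℕ} (x y : Sph q) : |dot x y| ≤ 1 := by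
  rw [dot_eq_inner]
  simpa [norm_coe_sph] using abs_real_inner_le_norm (x : Euc q) (y : Euc q)

theorem cos_gdist {q : ℕ} (x y : Sph q) : Real.cos (gdist x y) = dot x y :=
  Real.cos_arccos (abs_le.1 (abs_dot_le_one x y)).1 (abs_le.1 (abs_dot_le_one x y)).2

theorem gdist_nonneg {q : ℕ} (x y : Sph q) : 0 ≤ gdist x y := Real.arccos_nonneg _

theorem gdist_le_pi {q : ℕ} (x y : Sph q) : gdist x y ≤ Real.pi := Real.arccos_le_pi _

@[simp]
theorem gdist_self {q : ℕ} (x : Sph q) : gdist x x = 0 := by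
  rw [gdist, dot_eq_inner, real_inner_self_eq_norm_sq, norm_coe_sph]
  simp

theorem dist_sq_sph {q : ℕ} (x y : Sph q) : dist x y ^ 2 = 2 - 2 * Real.cos (gdist x y) := by
  rw [Subtype.dist_eq, dist_eq_norm, norm_sub_sq_real, norm_coe_sph, norm_coe_sph, cos_gdist,
    dot_eq_inner]
  ring

theorem dist_le_gdist {q : ℕ} (x y : Sph q) : dist x y ≤ gdist x y := by
  refine le_of_sq_le_sq ?_ (gdist_nonneg x y)
  rw [dist_sq_sph]
  linarith [Real.one_sub_sq_div_two_le_cos (x := gdist x y)]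

theorem gdist_le_two_mul_dist {q : ℕ} (x y : Sph q) : gdist x y ≤ 2 * dist x y := by
  refine le_of_sq_le_sq ?_ (by positivity)
  rw [mul_pow, dist_sq_sph]
  have h := Real.cos_le_one_sub_mul_cos_sq
    ((abs_of_nonneg (gdist_nonneg x y)).le.trans (gdist_le_pi x y))
  have hpi : Real.pi ^ 2 ≤ 16 := by nlinarith [Real.pi_le_four, Real.pi_pos]
  have h2 : 1 / 8 ≤ 2 / Real.pi ^ 2 := by
    rw [div_le_div_iff₀ (by norm_num) (by positivity)]
    linarith
  nlinarith [mul_le_mul_of_nonneg_right h2 (sq_nonneg (gdist x y))]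

theorem gdist_rotate {q : ℕ} (R : Euc q ≃ₗᵢ[ℝ] Euc q) (x y : Sph q) :
    gdist (rotate R x) (rotate R y) = gdist x y := by
  simp only [gdist, dot_eq_inner]
  congr 1
  exact R.inner_map_map _ _

theorem continuous_rotate {q : ℕ} (R : Euc q ≃ₗᵢ[ℝ] Euc q) : Continuous (rotate R) :=
  (R.continuous.comp continuous_subtype_val).subtype_mk _

theorem measurePreserving_rotate {q : ℕ} {μ : Measure (Sph q)} (hrot : RotInvariant q μ)
    (R : Euc q ≃ₗᵢ[ℝ] Euc q) : MeasurePreserving (rotate R) μ μ :=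
  ⟨(continuous_rotate R).measurable, hrot R⟩

/-- Rotations act transitively on the sphere. -/
theorem exists_rotate_eq {q : ℕ} (x y : Sph q) :
    ∃ R : Euc q ≃ₗᵢ[ℝ] Euc q, rotate R x = y :=
  ⟨(ℝ ∙ ((x : Euc q) - y))ᗮ.reflection, Subtype.ext
    (Submodule.reflection_sub ((norm_coe_sph x).trans (norm_coe_sph y).symm))⟩

theorem hasDerivAt_polyFun_comp {q : ℕ} (P : MvPolynomial (Fin (q + 1)) ℝ) {γ : ℝ → Euc q}
    {γ' : Euc q} {t : ℝ} (hγ : HasDerivAt γ γ' t) :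
    HasDerivAt (fun t => polyFun P (γ t)) (fderiv ℝ (polyFun P) (γ t) γ') t := by
  have h : HasFDerivAt (polyFun P) (fderiv ℝ (polyFun P) (γ t)) (γ t) :=
    ((contDiff_polyFun P).differentiable one_ne_zero (γ t)).hasFDerivAt
  exact h.comp_hasDerivAt t hγ

/-- The restriction to the sphere of a polynomial. -/
def sphFun {q : ℕ} (P : MvPolynomial (Fin (q + 1)) ℝ) (x : Sph q) : ℝ := polyFun P x

theorem sphFun_rotate {q : ℕ} (P : MvPolynomial (Fin (q + 1)) ℝ) (R : Euc q ≃ₗᵢ[ℝ] Euc q)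
    (x : Sph q) : sphFun P (rotate R x) = polyFun P (R x) :=
  rfl

theorem continuous_sphFun {q : ℕ} (P : MvPolynomial (Fin (q + 1)) ℝ) : Continuous (sphFun P) :=
  (contDiff_polyFun P).continuous.comp continuous_subtype_val

/-- The local maximal function of `f` at scale `θ`. -/
def locMax {q : ℕ} (θ : ℝ) (f : Sph q → ℝ) (x : Sph q) : ℝ :=
  ⨆ y : {y : Sph q // gdist x y < θ}, |f y|

theorem exists_abs_le {q : ℕ} {f : Sph q → ℝ} (hf : Continuous f) : ∃ B, ∀ x, |f x| ≤ B := by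
  obtain ⟨B, hB⟩ := isCompact_univ.exists_bound_of_continuousOn hf.continuousOn
  exact ⟨B, fun x => hB x (Set.mem_univ x)⟩

theorem abs_le_locMax {q : ℕ} {θ : ℝ} {f : Sph q → ℝ} (hf : Continuous f) {x y : Sph q}
    (h : gdist x y < θ) : |f y| ≤ locMax θ f x := by
  obtain ⟨B, hB⟩ := exists_abs_le hf
  exact le_ciSup (f := fun y : {y : Sph q // gdist x y < θ} => |f y|)
    ⟨B, by rintro _ ⟨y, rfl⟩; exact hB y⟩ ⟨y, h⟩

theorem locMax_le {q : ℕ} {θ : ℝ} (hθ : 0 < θ) {f : Sph q → ℝ} {x : Sph q} {B : ℝ}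
    (h : ∀ y, gdist x y < θ → |f y| ≤ B) : locMax θ f x ≤ B := by
  have : Nonempty {y : Sph q // gdist x y < θ} := ⟨⟨x, by simpa using hθ⟩⟩
  exact ciSup_le fun y => h y y.2

theorem locMax_nonneg {q : ℕ} (θ : ℝ) (f : Sph q → ℝ) (x : Sph q) : 0 ≤ locMax θ f x :=
  Real.iSup_nonneg fun _ => abs_nonneg _

theorem continuous_gdist {q : ℕ} (y : Sph q) : Continuous fun x => gdist x y := by
  unfold gdist
  simp only [dot_eq_inner]
  exact Real.continuous_arccos.comp
    (Continuous.inner continuous_subtype_val continuous_const)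

theorem measurable_locMax {q : ℕ} {θ : ℝ} (hθ : 0 < θ) {f : Sph q → ℝ} (hf : Continuous f) :
    Measurable (locMax θ f) := by
  refine measurable_of_Ioi fun a => ?_
  have : locMax θ f ⁻¹' Set.Ioi a = ⋃ y ∈ {y | a < |f y|}, {x | gdist x y < θ} := by
    ext x
    simp only [Set.mem_preimage, Set.mem_Ioi, Set.mem_iUnion, exists_prop]
    constructor
    · intro h
      by_contra! h'
      exact absurd (locMax_le hθ fun y hy => not_lt.1 fun hay => h' y hay hy) h.not_ge
    · rintro ⟨y, hy, hxy⟩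
      exact lt_of_lt_of_le hy (abs_le_locMax hf hxy)
  rw [this]
  exact (isOpen_biUnion fun y _ => isOpen_lt (continuous_gdist y) continuous_const).measurableSet

/-- The oscillation of a polynomial between nearby points is controlled by its local maximal
function at rotated points. -/
theorem abs_sub_le_locMax {q n N : ℕ} {b : Fin N → ℝ} {g : Fin N → Euc q ≃ₗᵢ[ℝ] Euc q}
    (hb : ∀ w, 0 ≤ b w)
    (hB : ∀ P : MvPolynomial (Fin (q + 1)) ℝ, P.totalDegree ≤ n → ∀ z v : Euc q, ‖z‖ = 1 →
        inner ℝ v z = 0 → |fderiv ℝ (polyFun P) z v| ≤ ‖v‖ * ∑ w, b w * |polyFun P (g w z)|)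
    {P : MvPolynomial (Fin (q + 1)) ℝ} (hP : P.totalDegree ≤ n) {θ : ℝ} (hθ : 0 < θ)
    (hθ1 : θ ≤ 1) {x y : Sph q} (hxy : gdist x y < θ) :
    |sphFun P y - sphFun P x| ≤ θ * ∑ w, b w * locMax θ (sphFun P) (rotate (g w) x) := by
  have hS : 0 ≤ ∑ w, b w * locMax θ (sphFun P) (rotate (g w) x) :=
    sum_nonneg fun w _ => mul_nonneg (hb w) (locMax_nonneg _ _ _)
  set φ := gdist x y with hφ
  have hφ0 : 0 ≤ φ := gdist_nonneg x y
  have hcos : inner ℝ (x : Euc q) (y : Euc q) = Real.cos φ := by rw [hφ, cos_gdist, dot_eq_inner]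
  rcases hφ0.eq_or_lt with h0 | hpos
  · have : x = y := by
      have := dist_le_gdist x y
      rw [← hφ, ← h0] at this
      exact dist_le_zero.1 this
    subst this
    simpa using mul_nonneg hθ.le hS
  have hsin : 0 < Real.sin φ :=
    Real.sin_pos_of_pos_of_lt_pi hpos (by linarith [Real.pi_gt_three])
  set u : Euc q := (Real.sin φ)⁻¹ • ((y : Euc q) - Real.cos φ • (x : Euc q)) with hu
  have hxx : inner ℝ (x : Euc q) (x : Euc q) = 1 := by
    rw [real_inner_self_eq_norm_sq, norm_coe_sph, one_pow]
  have hyy : inner ℝ (y : Euc q) (y : Euc q) = 1 := by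
    rw [real_inner_self_eq_norm_sq, norm_coe_sph, one_pow]
  have hxu : inner ℝ (x : Euc q) u = 0 := by
    rw [hu, inner_smul_right, inner_sub_right, inner_smul_right, hcos, hxx]
    ring
  have huu : inner ℝ u u = 1 := by
    rw [hu, inner_smul_left, inner_smul_right, inner_sub_left, inner_sub_right, inner_sub_right,
      inner_smul_left, inner_smul_right, inner_smul_left, inner_smul_right, hxx, hyy,
      real_inner_comm, hcos]
    simp only [conj_trivial]
    field_simp
    linear_combination -Real.sin_sq_add_cos_sq φ
  have hux : inner ℝ u (x : Euc q) = 0 := by rw [real_inner_comm, hxu]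
  set γ : ℝ → Euc q := fun t => Real.cos t • (x : Euc q) + Real.sin t • u with hγ
  set γ' : ℝ → Euc q := fun t => -Real.sin t • (x : Euc q) + Real.cos t • u with hγ'
  have hγd : ∀ t, HasDerivAt γ (γ' t) t := fun t =>
    ((Real.hasDerivAt_cos t).smul_const _).add ((Real.hasDerivAt_sin t).smul_const _)
  have hnorm : ∀ a b : ℝ, a ^ 2 + b ^ 2 = 1 → ‖a • (x : Euc q) + b • u‖ = 1 := by
    intro a b hab
    rw [← sq_eq_sq₀ (norm_nonneg _) zero_le_one, ← real_inner_self_eq_norm_sq]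
    simp only [inner_add_left, inner_add_right, inner_smul_left, inner_smul_right, hxx, huu, hxu,
      hux, conj_trivial]
    linear_combination hab
  have hγn : ∀ t, ‖γ t‖ = 1 := fun t => hnorm _ _ (by rw [add_comm]; exact Real.sin_sq_add_cos_sq t)
  have hγn' : ∀ t, ‖γ' t‖ = 1 := fun t => hnorm _ _ (by rw [neg_sq]; exact Real.sin_sq_add_cos_sq t)
  have horth : ∀ t, inner ℝ (γ' t) (γ t) = 0 := by
    intro t
    simp only [hγ, hγ', inner_add_left, inner_add_right, inner_smul_left, inner_smul_right, hxx,
      huu, hxu, hux, conj_trivial]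
    ring
  have hγ0 : γ 0 = x := by simp [hγ]
  have hγφ : γ φ = y := by
    simp only [hγ, hu, smul_smul, mul_inv_cancel₀ hsin.ne', one_smul]
    abel
  have hbound : ∀ t ∈ Set.Ico 0 φ, ‖fderiv ℝ (polyFun P) (γ t) (γ' t)‖ ≤
      ∑ w, b w * locMax θ (sphFun P) (rotate (g w) x) := by
    intro t ht
    have h1 := hB P hP (γ t) (γ' t) (hγn t) (horth t)
    rw [hγn', one_mul] at h1
    refine h1.trans (sum_le_sum fun w _ => mul_le_mul_of_nonneg_left ?_ (hb w))
    let z : Sph q := ⟨γ t, mem_sphere_zero_iff_norm.2 (hγn t)⟩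
    have hz : gdist x z < θ := by
      have : dot x z = Real.cos t := by
        rw [dot_eq_inner]
        simp only [z, hγ, inner_add_right, inner_smul_right, hxx, hxu]
        ring
      rw [gdist, this, Real.arccos_cos ht.1 (by linarith [Real.pi_gt_three, ht.2])]
      exact ht.2.trans hxy
    rw [← gdist_rotate (g w)] at hz
    have h2 := abs_le_locMax (continuous_sphFun P) hz
    rwa [sphFun_rotate] at h2
  have hder : ∀ t, HasDerivAt (fun t => polyFun P (γ t)) (fderiv ℝ (polyFun P) (γ t) (γ' t)) t :=
    fun t => hasDerivAt_polyFun_comp P (hγd t)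
  have hmv : ‖polyFun P (γ φ) - polyFun P (γ 0)‖ ≤
      (∑ w, b w * locMax θ (sphFun P) (rotate (g w) x)) * (φ - 0) :=
    norm_image_sub_le_of_norm_deriv_le_segment' (f := fun t => polyFun P (γ t))
      (fun t _ => (hder t).hasDerivWithinAt) hbound φ ⟨hφ0, le_rfl⟩
  rw [hγφ, hγ0, sub_zero, mul_comm] at hmv
  exact hmv.trans (mul_le_mul_of_nonneg_right hxy.le hS)

theorem memLp_of_continuous {q : ℕ} {μ : Measure (Sph q)} [IsProbabilityMeasure μ]
    {f : Sph q → ℝ} (hf : Continuous f) (p : ENNReal) : MemLp f p μ := by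
  obtain ⟨B, hB⟩ := exists_abs_le hf
  exact MemLp.of_bound hf.aestronglyMeasurable B (ae_of_all _ hB)

theorem memLp_locMax {q : ℕ} {μ : Measure (Sph q)} [IsProbabilityMeasure μ] {θ : ℝ} (hθ : 0 < θ)
    {f : Sph q → ℝ} (hf : Continuous f) (p : ENNReal) : MemLp (locMax θ f) p μ := by
  obtain ⟨B, hB⟩ := exists_abs_le hf
  refine MemLp.of_bound (measurable_locMax hθ hf).aestronglyMeasurable B (ae_of_all _ fun x => ?_)
  rw [Real.norm_of_nonneg (locMax_nonneg _ _ _)]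
  exact locMax_le hθ fun y _ => hB y

/-- A weighted average of rotations of a function. -/
theorem eLpNorm_sum_rotate_le {q N : ℕ} {μ : Measure (Sph q)} (hrot : RotInvariant q μ)
    {b : Fin N → ℝ} (hb : ∀ w, 0 ≤ b w) (g : Fin N → Euc q ≃ₗᵢ[ℝ] Euc q) {F : Sph q → ℝ}
    (hF : Measurable F) {p : ENNReal} (hp : 1 ≤ p) :
    eLpNorm (fun x => ∑ w, b w * F (rotate (g w) x)) p μ ≤
      ENNReal.ofReal (∑ w, b w) * eLpNorm F p μ := by
  have h1 : (fun x => ∑ w, b w * F (rotate (g w) x)) = ∑ w, b w • (F ∘ rotate (g w)) := by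
    ext x
    simp [Finset.sum_apply]
  rw [h1, ENNReal.ofReal_sum_of_nonneg fun w _ => hb w, sum_mul]
  refine (eLpNorm_sum_le (fun w _ => ?_) hp).trans (sum_le_sum fun w _ => ?_)
  · exact ((hF.comp (continuous_rotate _).measurable).const_smul _).aestronglyMeasurable
  · rw [eLpNorm_const_smul, eLpNorm_comp_measurePreserving hF.aestronglyMeasurable
      (measurePreserving_rotate hrot (g w)), Real.enorm_of_nonneg (hb w)]

/-- Moving the argument of a polynomial of degree `2 m` by a small multiple of `1 / m` changes it
little in every `L^p` norm. -/
theorem eLpNorm_comp_sub_le {q m : ℕ} (hm : 1 ≤ m) {μ : Measure (Sph q)} [IsProbabilityMeasure μ]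
    (hrot : RotInvariant q μ) {P : MvPolynomial (Fin (q + 1)) ℝ} (hP : P.totalDegree ≤ 2 * m)
    {σ : Sph q → Sph q} (hσ : ∀ x, gdist x (σ x) < 1 / (16 * m * (q + 1) ^ 2))
    {p : ENNReal} (hp : 1 ≤ p) :
    eLpNorm (fun x => sphFun P (σ x) - sphFun P x) p μ ≤ 2⁻¹ * eLpNorm (sphFun P) p μ := by
  obtain ⟨N, b, g, hb, hbs, hB⟩ := exists_bernstein q (n := 2 * m) (by omega)
  have hm' : (1 : ℝ) ≤ m := by exact_mod_cast hm
  have hq' : (1 : ℝ) ≤ (q + 1) ^ 2 := one_le_pow₀ (by simp)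
  set θ : ℝ := 1 / (16 * m * (q + 1) ^ 2) with hθdef
  have hθ : 0 < θ := by positivity
  have hθ1 : θ ≤ 1 := by
    rw [hθdef, div_le_one (by positivity)]
    nlinarith
  have hf := continuous_sphFun P
  set M := locMax θ (sphFun P) with hM
  have hMm : Measurable M := measurable_locMax hθ hf
  set S : Sph q → ℝ := fun x => ∑ w, (θ * b w) * M (rotate (g w) x) with hS
  have hmass : ∑ w, θ * b w ≤ 1 / 4 := by
    rw [← mul_sum]
    calc θ * ∑ w, b w ≤ θ * ((q + 1) ^ 2 * (2 * (2 * m : ℕ))) := by gcongr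
      _ = 1 / 4 := by
        rw [hθdef]
        push_cast
        field_simp
        norm_num
  have hosc : ∀ x y, gdist x y < θ → |sphFun P y - sphFun P x| ≤ S x := fun x y hxy => by
    have := abs_sub_le_locMax hb hB hP hθ hθ1 hxy
    simpa only [hS, mul_sum, mul_assoc] using this
  have hSn : eLpNorm S p μ ≤ 4⁻¹ * eLpNorm M p μ := by
    refine (eLpNorm_sum_rotate_le hrot (fun w => mul_nonneg hθ.le (hb w)) g hMm hp).trans ?_
    gcongr
    refine (ENNReal.ofReal_le_ofReal hmass).trans (le_of_eq ?_)
    rw [one_div, ENNReal.ofReal_inv_of_pos (by norm_num)]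
    norm_num
  have hSm : Measurable S := Finset.measurable_sum _ fun w _ =>
    (hMm.comp (continuous_rotate _).measurable).const_mul _
  have hMle : eLpNorm M p μ ≤ eLpNorm (sphFun P) p μ + eLpNorm S p μ := by
    refine le_trans (eLpNorm_mono_real (g := fun x => ‖sphFun P x‖ + S x) fun x => ?_)
      ((eLpNorm_add_le hf.norm.aestronglyMeasurable hSm.aestronglyMeasurable hp).trans
        (by rw [eLpNorm_norm]))
    rw [Real.norm_of_nonneg (locMax_nonneg _ _ _)]
    refine locMax_le hθ fun y hy => ?_
    have := hosc x y hy
    rw [Real.norm_eq_abs]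
    linarith [abs_sub_abs_le_abs_sub (sphFun P y) (sphFun P x)]
  have hMfin : eLpNorm M p μ ≠ ⊤ := (memLp_locMax hθ hf p).eLpNorm_ne_top
  have hPfin : eLpNorm (sphFun P) p μ ≠ ⊤ := (memLp_of_continuous hf p).eLpNorm_ne_top
  have hSfin : eLpNorm S p μ ≠ ⊤ :=
    ne_top_of_le_ne_top (ENNReal.mul_ne_top (by simp) hMfin) hSn
  refine (eLpNorm_mono_real fun x => hosc x (σ x) (hσ x)).trans ?_
  rw [← ENNReal.toReal_le_toReal hSfin (ENNReal.mul_ne_top (by simp) hPfin)]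
  have h1 := ENNReal.toReal_mono (ENNReal.mul_ne_top (by simp) hMfin) hSn
  have h2 := ENNReal.toReal_mono (ENNReal.add_ne_top.2 ⟨hPfin, hSfin⟩) hMle
  rw [ENNReal.toReal_add hPfin hSfin] at h2
  rw [ENNReal.toReal_mul] at h1 ⊢
  simp only [ENNReal.toReal_inv, ENNReal.toReal_ofNat] at h1 ⊢
  have : 0 ≤ (eLpNorm S p μ).toReal := ENNReal.toReal_nonneg
  linarith

theorem toReal_eLpNorm_eq {q : ℕ} {μ : Measure (Sph q)} {f : Sph q → ℝ} {p : ℝ}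
    (hp : 1 ≤ p) (hf : MemLp f (ENNReal.ofReal p) μ) :
    (eLpNorm f (ENNReal.ofReal p) μ).toReal = (∫ x, |f x| ^ p ∂μ) ^ (1 / p) := by
  rw [hf.eLpNorm_eq_integral_rpow_norm (by simp; linarith) ENNReal.ofReal_ne_top,
    ENNReal.toReal_ofReal (by positivity), ENNReal.toReal_ofReal (by linarith), one_div]
  rfl

theorem memLp_comp {q : ℕ} {μ : Measure (Sph q)} [IsProbabilityMeasure μ]
    {f : Sph q → ℝ} (hf : Continuous f) {σ : Sph q → Sph q} (hσ : Measurable σ) (p : ENNReal) :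
    MemLp (fun x => f (σ x)) p μ := by
  obtain ⟨B, hB⟩ := exists_abs_le hf
  exact MemLp.of_bound (hf.measurable.comp hσ).aestronglyMeasurable B (ae_of_all _ fun x => hB _)

/-- The upper Marcinkiewicz–Zygmund inequality. -/
theorem rpow_integral_comp_le {q m : ℕ} (hm : 1 ≤ m) {μ : Measure (Sph q)}
    [IsProbabilityMeasure μ] (hrot : RotInvariant q μ) {P : MvPolynomial (Fin (q + 1)) ℝ}
    (hP : P.totalDegree ≤ 2 * m) {σ : Sph q → Sph q} (hσm : Measurable σ)
    (hσ : ∀ x, gdist x (σ x) < 1 / (16 * m * (q + 1) ^ 2)) {p : ℝ} (hp : 1 ≤ p) :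
    (∫ x, |sphFun P (σ x)| ^ p ∂μ) ^ (1 / p) ≤ 2 * (∫ x, |sphFun P x| ^ p ∂μ) ^ (1 / p) := by
  have hf := continuous_sphFun P
  have hp' : 1 ≤ ENNReal.ofReal p := by simpa using hp
  have hPm := memLp_of_continuous (μ := μ) hf (ENNReal.ofReal p)
  have hQm := memLp_comp (μ := μ) hf hσm (ENNReal.ofReal p)
  rw [← toReal_eLpNorm_eq hp hPm, ← toReal_eLpNorm_eq hp hQm]
  have h1 := eLpNorm_comp_sub_le hm hrot hP hσ hp'
  have h2 : eLpNorm (fun x => sphFun P (σ x)) (ENNReal.ofReal p) μ ≤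
      eLpNorm (fun x => sphFun P (σ x) - sphFun P x) (ENNReal.ofReal p) μ +
        eLpNorm (sphFun P) (ENNReal.ofReal p) μ := by
    refine le_trans (le_of_eq ?_) (eLpNorm_add_le (hQm.sub hPm).1 hPm.1 hp')
    congr 1
    ext x
    simp
  have h3 : eLpNorm (fun x => sphFun P (σ x)) (ENNReal.ofReal p) μ ≤
      2 * eLpNorm (sphFun P) (ENNReal.ofReal p) μ := by
    refine h2.trans ((add_le_add_left h1 _).trans ?_)
    rw [two_mul]
    gcongr
    exact mul_le_of_le_one_left zero_le (by simp)
  have := ENNReal.toReal_mono (ENNReal.mul_ne_top (by simp) hPm.eLpNorm_ne_top) h3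
  simpa using this

/-- The lower Marcinkiewicz–Zygmund inequality for the exponent one. -/
theorem integral_abs_le_comp {q m : ℕ} (hm : 1 ≤ m) {μ : Measure (Sph q)}
    [IsProbabilityMeasure μ] (hrot : RotInvariant q μ) {P : MvPolynomial (Fin (q + 1)) ℝ}
    (hP : P.totalDegree ≤ 2 * m) {σ : Sph q → Sph q} (hσm : Measurable σ)
    (hσ : ∀ x, gdist x (σ x) < 1 / (16 * m * (q + 1) ^ 2)) :
    ∫ x, |sphFun P x| ∂μ ≤ 2 * ∫ x, |sphFun P (σ x)| ∂μ := by
  have hf := continuous_sphFun P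
  have hPm := memLp_of_continuous (μ := μ) hf 1
  have hQm := memLp_comp (μ := μ) hf hσm 1
  have hd : MemLp (fun x => sphFun P (σ x) - sphFun P x) 1 μ := hQm.sub hPm
  have h1 := eLpNorm_comp_sub_le hm hrot hP hσ le_rfl
  have e : ∀ f : Sph q → ℝ, MemLp f 1 μ → (eLpNorm f 1 μ).toReal = ∫ x, |f x| ∂μ := fun f hf => by
    have := toReal_eLpNorm_eq le_rfl (by simpa using hf)
    simpa using this
  have h2 := ENNReal.toReal_mono (ENNReal.mul_ne_top (by simp) hPm.eLpNorm_ne_top) h1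
  rw [ENNReal.toReal_mul, e _ hPm, e _ hd] at h2
  simp only [ENNReal.toReal_inv, ENNReal.toReal_ofNat] at h2
  have h3 : ∫ x, |sphFun P x| ∂μ ≤
      ∫ x, (|sphFun P (σ x) - sphFun P x| + |sphFun P (σ x)|) ∂μ := by
    refine integral_mono (memLp_one_iff_integrable.1 hPm).abs
      ((memLp_one_iff_integrable.1 hd).abs.add
        (memLp_one_iff_integrable.1 hQm).abs) fun x => ?_
    have := abs_sub_abs_le_abs_sub (sphFun P x) (sphFun P (σ x))
    rw [abs_sub_comm] at this
    dsimp only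
    linarith
  rw [integral_add (memLp_one_iff_integrable.1 hd).abs
    (memLp_one_iff_integrable.1 hQm).abs] at h3
  linarith

theorem one_add_pow_sub_one_sub_pow_le {a : ℝ} (h0 : 0 ≤ a) (h1 : a ≤ 1) (n : ℕ) :
    (1 + a) ^ n - (1 - a) ^ n ≤ 2 * n * a * 2 ^ n := by
  induction n with
  | zero => simp
  | succ n ih =>
    have h2 : (1 - a) ^ n ≤ 2 ^ n := pow_le_pow_left₀ (by linarith) (by linarith) n
    have h3 : 0 ≤ (1 + a) ^ n - (1 - a) ^ n :=
      sub_nonneg.2 (pow_le_pow_left₀ (by linarith) (by linarith) n)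
    have h4 : (1 + a) * ((1 + a) ^ n - (1 - a) ^ n) ≤ 2 * (2 * n * a * 2 ^ n) :=
      mul_le_mul (by linarith) ih h3 (by norm_num)
    have h5 : 2 * a * (1 - a) ^ n ≤ 2 * a * 2 ^ n := by gcongr
    have h6 : (0 : ℝ) ≤ a * 2 ^ n := by positivity
    push_cast
    rw [pow_succ, pow_succ, pow_succ]
    nlinarith

/-- The number of points of a separated subset of the sphere, by comparison of volumes in a
thin shell around the sphere. -/
theorem card_mul_pow_le_of_separated {q : ℕ} {S : Finset (Sph q)} {a : ℝ} (h0 : 0 < a)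
    (h1 : a ≤ 1) (hS : ∀ x ∈ S, ∀ y ∈ S, x ≠ y → 2 * a ≤ dist x y) :
    (#S : ℝ) * a ^ q ≤ 2 * (q + 1) * 2 ^ (q + 1) := by
  set V : ℝ := (volume : Measure (Euc q)).real (Metric.ball 0 1) with hV
  have hVpos : 0 < V := ENNReal.toReal_pos (Metric.measure_ball_pos _ _ one_pos).ne'
    measure_ball_lt_top.ne
  have hball : ∀ (x : Euc q) (r : ℝ), 0 ≤ r →
      (volume : Measure (Euc q)).real (Metric.ball x r) = r ^ (q + 1) * V := fun x r hr => by
    rw [measureReal_def, Measure.addHaar_ball _ _ hr, ENNReal.toReal_mul,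
      ENNReal.toReal_ofReal (by positivity), finrank_euclideanSpace_fin]
    rfl
  have hdisj : (S : Set (Sph q)).PairwiseDisjoint fun ξ => Metric.ball (ξ : Euc q) a :=
    fun x hx y hy hxy => Metric.ball_disjoint_ball (by
      have := hS x hx y hy hxy
      rw [Subtype.dist_eq] at this
      linarith)
  have hsum : (volume : Measure (Euc q)).real (⋃ ξ ∈ S, Metric.ball (ξ : Euc q) a) =
      #S * (a ^ (q + 1) * V) := by
    rw [measureReal_biUnion_finset hdisj (fun _ _ => measurableSet_ball)
      (fun _ _ => measure_ball_lt_top.ne)]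
    simp [hball _ _ h0.le]
  have hsub : (⋃ ξ ∈ S, Metric.ball (ξ : Euc q) a) ⊆
      Metric.ball (0 : Euc q) (1 + a) \ Metric.ball (0 : Euc q) (1 - a) := by
    intro z hz
    simp only [Set.mem_iUnion, exists_prop] at hz
    obtain ⟨ξ, _, hξ⟩ := hz
    rw [mem_ball_iff_norm] at hξ
    have hn := norm_coe_sph ξ
    have ha := norm_sub_norm_le z (ξ : Euc q)
    have hb := norm_sub_norm_le (ξ : Euc q) z
    rw [norm_sub_rev] at hb
    simp only [Set.mem_sdiff, mem_ball_zero_iff, not_lt]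
    exact ⟨by linarith, by linarith⟩
  have hle := measureReal_mono hsub
    (ne_top_of_le_ne_top (measure_ball_lt_top (μ := volume) (x := (0 : Euc q)) (r := 1 + a)).ne
      (measure_mono Set.sdiff_subset))
  rw [hsum, measureReal_sdiff (Metric.ball_subset_ball (by linarith)) measurableSet_ball,
    hball _ _ (by linarith), hball _ _ (by linarith), ← sub_mul, ← mul_assoc] at hle
  have h2 := (le_of_mul_le_mul_right hle hVpos).trans
    (one_add_pow_sub_one_sub_pow_le h0.le h1 (q + 1))
  rw [pow_succ] at h2
  refine le_of_mul_le_mul_right ?_ h0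
  calc (#S : ℝ) * a ^ q * a = #S * (a ^ q * a) := by ring
    _ ≤ _ := h2
    _ = 2 * (q + 1) * 2 ^ (q + 1) * a := by push_cast; ring

/-- The point of the sphere above the grid point `a / (m q)` of the unit ball. -/
theorem exists_grid {q m : ℕ} (hq : 1 ≤ q) (hm : 1 ≤ m) :
    ∃ f : (Fin q → Fin m) → Sph q, ∀ a b, a ≠ b → 1 / (m * q : ℝ) ≤ dist (f a) (f b) := by
  have hm' : (0 : ℝ) < m := by exact_mod_cast hm
  have hq' : (0 : ℝ) < q := by exact_mod_cast hq
  let y : (Fin q → Fin m) → Fin q → ℝ := fun a i => (a i : ℕ) / (m * q : ℝ)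
  have hy : ∀ a, ∑ i, y a i ^ 2 ≤ 1 := by
    intro a
    calc ∑ i, y a i ^ 2 ≤ ∑ _i : Fin q, (1 / q : ℝ) := by
          refine sum_le_sum fun i _ => ?_
          have h0 : 0 ≤ y a i := by positivity
          have h1 : y a i ≤ 1 / q := by
            have : ((a i : ℕ) : ℝ) ≤ m := by exact_mod_cast (a i).2.le
            calc y a i ≤ m / (m * q : ℝ) := by simp only [y]; gcongr
              _ = 1 / q := by field_simp
          have h2 : (1 / q : ℝ) ≤ 1 := by
            rw [div_le_one hq']
            exact_mod_cast hq
          nlinarith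
      _ = 1 := by
          simp
          field_simp
  let f : (Fin q → Fin m) → Sph q := fun a =>
    ⟨WithLp.toLp 2 (Fin.cons (Real.sqrt (1 - ∑ i, y a i ^ 2)) (y a)), by
      rw [mem_sphere_zero_iff_norm, ← sq_eq_sq₀ (norm_nonneg _) zero_le_one,
        EuclideanSpace.norm_sq_eq, Fin.sum_univ_succ]
      simp [Real.sq_sqrt (sub_nonneg.2 (hy a))]⟩
  refine ⟨f, fun a b hab => ?_⟩
  obtain ⟨i, hi⟩ := Function.ne_iff.1 hab
  have h1 : |y a i - y b i| ≤ dist (f a) (f b) := by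
    rw [Subtype.dist_eq, dist_eq_norm]
    simpa [f] using PiLp.norm_apply_le ((f a : Euc q) - (f b : Euc q)) i.succ
  refine le_trans ?_ h1
  have h2 : (1 : ℝ) ≤ |((a i : ℕ) : ℝ) - (b i : ℕ)| := by
    have : (1 : ℤ) ≤ |((a i : ℕ) : ℤ) - (b i : ℕ)| :=
      Int.one_le_abs (sub_ne_zero.2 fun h => hi (Fin.ext (by exact_mod_cast h)))
    exact_mod_cast this
  simp only [y]
  rw [← sub_div, abs_div, abs_of_pos (by positivity : (0 : ℝ) < m * q)]
  gcongr

/-- Small balls have small measure, by packing. -/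
theorem measureReal_ball_mul_le {q m : ℕ} (hq : 1 ≤ q) (hm : 1 ≤ m) {μ : Measure (Sph q)}
    [IsProbabilityMeasure μ] (hrot : RotInvariant q μ) {r : ℝ} (hr : 2 * r ≤ 1 / (m * q))
    (x : Sph q) : (m : ℝ) ^ q * μ.real (Metric.ball x r) ≤ 1 := by
  obtain ⟨f, hf⟩ := exists_grid hq hm
  have heq : ∀ y, μ.real (Metric.ball y r) = μ.real (Metric.ball x r) := by
    intro y
    obtain ⟨R, hR⟩ := exists_rotate_eq y x
    have h := (measurePreserving_rotate hrot R).measureReal_preimage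
      (measurableSet_ball (x := x) (ε := r)).nullMeasurableSet
    rw [← h]
    congr 1
    ext z
    rw [Set.mem_preimage, Metric.mem_ball, Metric.mem_ball, ← hR, Subtype.dist_eq,
      Subtype.dist_eq]
    show _ ↔ dist (R (z : Euc q)) (R (y : Euc q)) < r
    rw [R.dist_map]
  have hdisj : (Set.univ : Set (Fin q → Fin m)).PairwiseDisjoint fun a => Metric.ball (f a) r :=
    fun a _ b _ hab => Metric.ball_disjoint_ball (by linarith [hf a b hab])
  have h := measureReal_biUnion_finset (μ := μ) (s := (univ : Finset (Fin q → Fin m)))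
    (f := fun a => Metric.ball (f a) r) (by simpa using hdisj) (fun _ _ => measurableSet_ball)
    (fun _ _ => measure_ne_top _ _)
  simp only [heq, sum_const, card_univ, Fintype.card_pi, Fintype.card_fin, prod_const,
    nsmul_eq_mul] at h
  push_cast at h
  rw [← h]
  exact measureReal_le_one

theorem exists_separated_net {α : Type*} [PseudoMetricSpace α] (C : Finset α) {ρ : ℝ}
    (hρ : 0 ≤ ρ) :
    ∃ S ⊆ C, (∀ x ∈ S, ∀ y ∈ S, x ≠ y → ρ < dist x y) ∧ ∀ x ∈ C, ∃ y ∈ S, dist x y ≤ ρ := by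
  classical
  induction C using Finset.induction_on with
  | empty => exact ⟨∅, by simp⟩
  | insert a C _ ih =>
    obtain ⟨S, hSC, hsep, hnet⟩ := ih
    by_cases h : ∃ y ∈ S, dist a y ≤ ρ
    · refine ⟨S, hSC.trans (subset_insert _ _), hsep, fun x hx => ?_⟩
      rcases mem_insert.1 hx with rfl | hx
      · exact h
      · exact hnet x hx
    · push Not at h
      refine ⟨insert a S, insert_subset_insert _ hSC, ?_, fun x hx => ?_⟩
      · intro x hx y hy hxy
        rcases mem_insert.1 hx with hxa | hx <;> rcases mem_insert.1 hy with hya | hy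
        · exact absurd (hxa.trans hya.symm) hxy
        · exact hxa ▸ h y hy
        · rw [dist_comm]
          exact hya ▸ h x hx
        · exact hsep x hx y hy hxy
      · rcases mem_insert.1 hx with rfl | hx
        · exact ⟨x, mem_insert_self _ _, by simpa using hρ⟩
        · obtain ⟨y, hy, hxy⟩ := hnet x hx
          exact ⟨y, mem_insert_of_mem hy, hxy⟩

/-- A measurable choice of a nearest point in a finite set. -/
theorem exists_measurable_nearest {α : Type*} [PseudoMetricSpace α] [MeasurableSpace α]
    [OpensMeasurableSpace α] [SecondCountableTopology α] {S : Finset α} (hS : S.Nonempty) :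
    ∃ σ : α → α, Measurable σ ∧ (∀ x, σ x ∈ S) ∧ ∀ x, ∀ ξ ∈ S, dist x (σ x) ≤ dist x ξ := by
  classical
  induction hS using Finset.Nonempty.cons_induction with
  | singleton a => exact ⟨fun _ => a, measurable_const, by simp, by simp⟩
  | cons a S ha hS ih =>
    obtain ⟨σ, hσ, hmem, hle⟩ := ih
    refine ⟨fun x => if dist x a ≤ dist x (σ x) then a else σ x, ?_, fun x => ?_, fun x ξ hξ => ?_⟩
    · exact Measurable.ite (measurableSet_le (measurable_id.dist measurable_const)
        (measurable_id.dist hσ)) measurable_const hσ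
    · dsimp only
      split_ifs
      · simp
      · simp [hmem x]
    · dsimp only
      rcases mem_cons.1 hξ with rfl | hξ
      · split_ifs with h
        · exact le_rfl
        · exact (not_le.1 h).le
      · split_ifs with h
        · exact h.trans (hle x ξ hξ)
        · exact hle x ξ hξ

/-- A linear functional dominated by a weighted `ℓ¹` norm over a finite set is given by
weights on this set, by the Hahn–Banach theorem. -/
theorem exists_weights_of_le {X : Type*} (V : Submodule ℝ (X → ℝ)) (l : V →ₗ[ℝ] ℝ)
    (S : Finset X) {v : X → ℝ} (hv : ∀ ξ, 0 ≤ v ξ)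
    (h : ∀ f : V, l f ≤ ∑ ξ ∈ S, v ξ * |(f : X → ℝ) ξ|) :
    ∃ w : X → ℝ, (∀ ξ, |w ξ| ≤ v ξ) ∧ (∀ ξ ∉ S, w ξ = 0) ∧
      ∀ f : V, ∑ ξ ∈ S, w ξ * (f : X → ℝ) ξ = l f := by
  classical
  obtain ⟨g, hg, hN⟩ := exists_extension_of_le_sublinear ⟨V, l⟩
    (fun f => ∑ ξ ∈ S, v ξ * |f ξ|)
    (fun c hc f => by
      simp only [Pi.smul_apply, smul_eq_mul, abs_mul, abs_of_pos hc, mul_sum]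
      exact sum_congr rfl fun _ _ => by ring)
    (fun f g => by
      rw [← sum_add_distrib]
      refine sum_le_sum fun ξ _ => ?_
      rw [← mul_add]
      exact mul_le_mul_of_nonneg_left (abs_add_le _ _) (hv ξ))
    h
  have hN' : ∀ f : X → ℝ, |g f| ≤ ∑ ξ ∈ S, v ξ * |f ξ| := fun f => by
    refine abs_le'.2 ⟨hN f, ?_⟩
    rw [← map_neg]
    simpa using hN (-f)
  have hsum : ∀ ξ, ∑ η ∈ S, v η * |(Pi.single ξ 1 : X → ℝ) η| = if ξ ∈ S then v ξ else 0 := by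
    intro ξ
    rw [← sum_ite_eq' S ξ v]
    refine sum_congr rfl fun η _ => ?_
    by_cases e : η = ξ <;> simp [e]
  refine ⟨fun ξ => g (Pi.single ξ 1), fun ξ => ?_, fun ξ hξ => ?_, fun f => ?_⟩
  · refine (hN' _).trans ?_
    rw [hsum]
    split_ifs
    · exact le_rfl
    · exact hv ξ
  · have := hN' (Pi.single ξ 1)
    rw [hsum, if_neg hξ] at this
    exact abs_nonpos_iff.1 this
  · have h0 : g ((f : X → ℝ) - ∑ ξ ∈ S, (f : X → ℝ) ξ • (Pi.single ξ 1 : X → ℝ)) = 0 := by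
      refine abs_nonpos_iff.1 ((hN' _).trans (le_of_eq (sum_eq_zero fun ξ hξ => ?_)))
      simp [Finset.sum_apply, Pi.single_apply, hξ]
    rw [map_sub, map_sum, sub_eq_zero] at h0
    refine Eq.trans ?_ (h0.symm.trans (hg f))
    exact sum_congr rfl fun ξ _ => by rw [map_smul, smul_eq_mul, mul_comm]

theorem integral_comp_eq_sum {q : ℕ} {μ : Measure (Sph q)} [IsProbabilityMeasure μ]
    {S : Finset (Sph q)} {σ : Sph q → Sph q} (hσ : Measurable σ) (hS : ∀ x, σ x ∈ S)
    (F : Sph q → ℝ) : ∫ x, F (σ x) ∂μ = ∑ ξ ∈ S, μ.real (σ ⁻¹' {ξ}) * F ξ := by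
  classical
  have h : ∀ x, F (σ x) = ∑ ξ ∈ S, (σ ⁻¹' {ξ}).indicator (fun _ => F ξ) x := fun x => by
    simp only [Set.indicator_apply, Set.mem_preimage, Set.mem_singleton_iff]
    rw [sum_ite_eq, if_pos (hS x)]
  have hm : ∀ ξ, MeasurableSet (σ ⁻¹' {ξ}) := fun ξ => hσ (measurableSet_singleton ξ)
  simp only [h]
  rw [integral_finsetSum _ fun ξ _ => (integrable_const _).indicator (hm ξ)]
  exact sum_congr rfl fun ξ _ => by rw [integral_indicator_const _ (hm ξ), smul_eq_mul]

theorem InPi.exists_eq_sphFun {q n : ℕ} {f : Sph q → ℝ} (hf : InPi q n f) :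
    ∃ P : MvPolynomial (Fin (q + 1)) ℝ, P.totalDegree ≤ n ∧ f = sphFun P := by
  obtain ⟨P, hP, h⟩ := hf
  exact ⟨P, hP, funext h⟩

theorem inPi_const (q n : ℕ) (a : ℝ) : InPi q n fun _ => a :=
  ⟨MvPolynomial.C a, by simp, by simp⟩

/-- The space `Π_n^q`. -/
def piSubmodule (q n : ℕ) : Submodule ℝ (Sph q → ℝ) where
  carrier := {f | InPi q n f}
  zero_mem' := inPi_const q n 0
  add_mem' := by
    rintro f g ⟨P, hP, hf⟩ ⟨Q, hQ, hg⟩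
    exact ⟨P + Q, (MvPolynomial.totalDegree_add _ _).trans (max_le hP hQ), fun x => by
      simp [hf, hg]⟩
  smul_mem' := by
    rintro c f ⟨P, hP, hf⟩
    exact ⟨c • P, (MvPolynomial.totalDegree_smul_le _ _).trans hP, fun x => by simp [hf]⟩

theorem InPi.integrable {q n : ℕ} {μ : Measure (Sph q)} [IsProbabilityMeasure μ]
    {f : Sph q → ℝ} (hf : InPi q n f) : Integrable f μ := by
  obtain ⟨P, _, rfl⟩ := hf.exists_eq_sphFun
  exact memLp_one_iff_integrable.1 (memLp_of_continuous (continuous_sphFun P) 1)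

/-- Integration as a linear functional on `Π_n^q`. -/
def piIntegral (q n : ℕ) (μ : Measure (Sph q)) [IsProbabilityMeasure μ] :
    piSubmodule q n →ₗ[ℝ] ℝ where
  toFun f := ∫ x, (f : Sph q → ℝ) x ∂μ
  map_add' f g := integral_add (InPi.integrable f.2) (InPi.integrable g.2)
  map_smul' c _ := integral_const_mul c _

/-- Every point of the sphere is within the mesh norm of the point set. -/
theorem exists_dist_le_meshNorm {q : ℕ} {C : Finset (Sph q)} (hC : C.Nonempty) (x : Sph q) :
    ∃ ξ ∈ C, dist x ξ ≤ meshNorm C := by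
  have hfin : ∀ y : Sph q, ((fun ξ => gdist y ξ) '' (C : Set (Sph q))).Finite := fun y =>
    C.finite_toSet.image _
  have hne : ∀ y : Sph q, ((fun ξ => gdist y ξ) '' (C : Set (Sph q))).Nonempty := fun y =>
    (coe_nonempty.2 hC).image _
  have hmem := fun y => (hne y).csInf_mem (hfin y)
  have hbdd : BddAbove (Set.range fun y : Sph q =>
      sInf ((fun ξ => gdist y ξ) '' (C : Set (Sph q)))) := by
    refine ⟨Real.pi, ?_⟩
    rintro _ ⟨y, rfl⟩
    obtain ⟨ξ, _, hξ⟩ := hmem y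
    exact hξ.symm.le.trans (gdist_le_pi y ξ)
  obtain ⟨ξ, hξC, hξ⟩ := hmem x
  exact ⟨ξ, hξC, (dist_le_gdist x ξ).trans (hξ.le.trans (le_ciSup hbdd x))⟩

/-- Quadrature weights dominated by the masses of the fibers of a map close to the identity. -/
theorem exists_quadrature_weights {q m : ℕ} (hm : 1 ≤ m) {μ : Measure (Sph q)}
    [IsProbabilityMeasure μ] (hrot : RotInvariant q μ) {S : Finset (Sph q)}
    {σ : Sph q → Sph q} (hσm : Measurable σ) (hS : ∀ x, σ x ∈ S)
    (hσ : ∀ x, gdist x (σ x) < 1 / (16 * m * (q + 1) ^ 2)) :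
    ∃ w : Sph q → ℝ, (∀ ξ, |w ξ| ≤ 2 * μ.real (σ ⁻¹' {ξ})) ∧ (∀ ξ ∉ S, w ξ = 0) ∧
      MZQuad q μ m S w 4 := by
  obtain ⟨w, hw, hw0, hwS⟩ := exists_weights_of_le (piSubmodule q (2 * m))
    (piIntegral q (2 * m) μ) S (v := fun ξ => 2 * μ.real (σ ⁻¹' {ξ})) (fun ξ => by positivity)
    (fun f => by
      obtain ⟨P, hP, hf⟩ := InPi.exists_eq_sphFun f.2
      calc ∫ x, (f : Sph q → ℝ) x ∂μ ≤ ∫ x, |(f : Sph q → ℝ) x| ∂μ :=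
            (le_abs_self _).trans abs_integral_le_integral_abs
        _ ≤ 2 * ∫ x, |(f : Sph q → ℝ) (σ x)| ∂μ := by
            rw [hf]
            exact integral_abs_le_comp hm hrot hP hσm hσ
        _ = _ := by
            rw [integral_comp_eq_sum hσm hS (fun y => |(f : Sph q → ℝ) y|), mul_sum]
            exact sum_congr rfl fun _ _ => by ring)
  refine ⟨w, hw, hw0, fun f hf => hwS ⟨f, hf⟩, fun f hf p hp => ?_⟩
  obtain ⟨P, hP, rfl⟩ := hf.exists_eq_sphFun
  have hp0 : 0 < p := by linarith
  have hle : ∑ ξ ∈ S, |w ξ| * |sphFun P ξ| ^ p ≤ 2 * ∫ x, |sphFun P (σ x)| ^ p ∂μ := by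
    rw [integral_comp_eq_sum hσm hS (fun y => |sphFun P y| ^ p), mul_sum]
    refine sum_le_sum fun ξ _ => ?_
    rw [← mul_assoc]
    exact mul_le_mul_of_nonneg_right (hw ξ) (by positivity)
  have hI : 0 ≤ ∫ x, |sphFun P (σ x)| ^ p ∂μ := integral_nonneg fun x => by positivity
  have hJ : 0 ≤ ∫ x, |sphFun P x| ^ p ∂μ := integral_nonneg fun x => by positivity
  have h2 : (2 : ℝ) ^ (1 / p) ≤ 2 := by
    conv_rhs => rw [← Real.rpow_one 2]
    exact Real.rpow_le_rpow_of_exponent_le (by norm_num) ((div_le_one hp0).2 hp)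
  calc (∑ ξ ∈ S, |w ξ| * |sphFun P ξ| ^ p) ^ (1 / p)
      ≤ (2 * ∫ x, |sphFun P (σ x)| ^ p ∂μ) ^ (1 / p) :=
        Real.rpow_le_rpow (sum_nonneg fun _ _ => by positivity) hle (by positivity)
    _ = 2 ^ (1 / p) * (∫ x, |sphFun P (σ x)| ^ p ∂μ) ^ (1 / p) :=
        Real.mul_rpow (by norm_num) hI
    _ ≤ 2 * (2 * (∫ x, |sphFun P x| ^ p ∂μ) ^ (1 / p)) :=
        mul_le_mul h2 (rpow_integral_comp_le hm hrot hP hσm hσ hp) (by positivity) (by norm_num)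
    _ = _ := by ring

theorem MZQuad.superset {q m : ℕ} {μ : Measure (Sph q)} {S C : Finset (Sph q)}
    {w : Sph q → ℝ} {c₀ : ℝ} (h : MZQuad q μ m S w c₀) (hSC : S ⊆ C) (hw : ∀ ξ ∉ S, w ξ = 0) :
    MZQuad q μ m C w c₀ := by
  refine ⟨fun P hP => ?_, fun P hP p hp => ?_⟩
  · rw [← h.1 P hP]
    exact (sum_subset hSC fun ξ _ hξ => by simp [hw ξ hξ]).symm
  · refine le_of_eq_of_le (congrArg (· ^ (1 / p)) ?_) (h.2 P hP p hp)
    exact (sum_subset hSC fun ξ _ hξ => by simp [hw ξ hξ]).symm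

/-- The support of quadrature weights bounded by `2 m⁻ᵠ` has at least `mᵠ / 2` points. -/
theorem MZQuad.le_card_support {q m : ℕ} {μ : Measure (Sph q)} [IsProbabilityMeasure μ]
    {C : Finset (Sph q)} {w : Sph q → ℝ} {c₀ : ℝ} (h : MZQuad q μ m C w c₀)
    (hw : ∀ ξ, (m : ℝ) ^ q * |w ξ| ≤ 2) :
    1 / 2 * (m : ℝ) ^ q ≤ #{ξ ∈ C | w ξ ≠ 0} := by
  have h1 : ∑ ξ ∈ C, w ξ = 1 := by simpa using h.1 _ (inPi_const q (2 * m) 1)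
  rw [← sum_filter_ne_zero] at h1
  have h2 : (m : ℝ) ^ q ≤ #{ξ ∈ C | w ξ ≠ 0} * 2 := by
    calc (m : ℝ) ^ q = ∑ ξ ∈ C with w ξ ≠ 0, (m : ℝ) ^ q * w ξ := by rw [← mul_sum, h1, mul_one]
      _ ≤ ∑ ξ ∈ C with w ξ ≠ 0, (2 : ℝ) := sum_le_sum fun ξ _ =>
          (mul_le_mul_of_nonneg_left (le_abs_self _) (by positivity)).trans (hw ξ)
      _ = _ := by simp
  linarith

/-- Existence of M–Z quadratures based on scattered data: if `m ≤ α_q δ_C(S^q)⁻¹` then `C`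
admits an M–Z quadrature of order `m` with the number of nonzero weights comparable
to `m^q ∼ dim Π_{2m}^q`. -/
theorem statement5 (q : ℕ) (hq : 1 ≤ q)
    (μ : Measure (Sph q)) (hμ : IsProbabilityMeasure μ) (hrot : RotInvariant q μ) :
    ∃ α c₀ c c' : ℝ, 0 < α ∧ 0 < c₀ ∧ 0 < c ∧ 0 < c' ∧
      ∀ C : Finset (Sph q), C.Nonempty → ∀ m : ℕ, 1 ≤ m → (m : ℝ) * meshNorm C ≤ α →
        ∃ w : Sph q → ℝ, MZQuad q μ m C w c₀ ∧
          c * (m : ℝ) ^ q ≤ ({ξ ∈ (C : Set (Sph q)) | w ξ ≠ 0}.ncard : ℝ) ∧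
          ({ξ ∈ (C : Set (Sph q)) | w ξ ≠ 0}.ncard : ℝ) ≤ c' * (m : ℝ) ^ q := by
  refine ⟨1 / (100 * (q + 1) ^ 2), 4, 1 / 2,
    2 * (q + 1) * 2 ^ (q + 1) * (200 * (q + 1) ^ 2) ^ q, by positivity, by norm_num, by norm_num,
    by positivity, fun C hC m hm hmesh => ?_⟩
  have hm0 : (1 : ℝ) ≤ m := by exact_mod_cast hm
  have hq0 : (1 : ℝ) ≤ q := by exact_mod_cast hq
  set t : ℝ := 1 / (m * (q + 1) ^ 2) with ht
  have ht0 : 0 < t := by positivity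
  have ht1 : t ≤ 1 := by
    rw [ht, div_le_one (by positivity)]
    nlinarith
  have htq : t ≤ 1 / (m * q) := by
    rw [ht]
    gcongr
    nlinarith
  have hmesh' : meshNorm C ≤ t / 100 := by
    refine le_of_mul_le_mul_left (hmesh.trans_eq ?_) (by linarith : (0 : ℝ) < m)
    rw [ht]
    field_simp
  obtain ⟨S, hSC, hsep, hnet⟩ := exists_separated_net C (ρ := t / 100) (by positivity)
  have hcov : ∀ x : Sph q, ∃ ξ ∈ S, dist x ξ ≤ t / 50 := fun x => by
    obtain ⟨η, hη, hxη⟩ := exists_dist_le_meshNorm hC x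
    obtain ⟨ξ, hξ, hηξ⟩ := hnet η hη
    exact ⟨ξ, hξ, by linarith [dist_triangle x η ξ]⟩
  obtain ⟨η, hη⟩ := hC
  obtain ⟨ξ₀, hξ₀, _⟩ := hcov η
  obtain ⟨σ, hσm, hσS, hσ⟩ := exists_measurable_nearest ⟨ξ₀, hξ₀⟩
  have hσt : ∀ x, dist x (σ x) ≤ t / 50 := fun x => by
    obtain ⟨ξ, hξ, hxξ⟩ := hcov x
    exact (hσ x ξ hξ).trans hxξ
  have hσg : ∀ x, gdist x (σ x) < 1 / (16 * m * (q + 1) ^ 2) := fun x => by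
    have h16 : 1 / (16 * m * (q + 1) ^ 2) = t / 16 := by
      rw [ht]
      field_simp
    rw [h16]
    linarith [gdist_le_two_mul_dist x (σ x), hσt x]
  obtain ⟨w, hw, hw0, hMZ⟩ := exists_quadrature_weights hm hrot hσm hσS hσg
  have hMZC := hMZ.superset hSC hw0
  have hcard : ({ξ ∈ (C : Set (Sph q)) | w ξ ≠ 0}.ncard : ℝ) = #{ξ ∈ C | w ξ ≠ 0} := by
    rw [← Set.ncard_coe_finset, coe_filter]
    rfl
  refine ⟨w, hMZC, ?_⟩
  rw [hcard]
  refine ⟨hMZC.le_card_support fun ξ => ?_, ?_⟩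
  · have hsub : σ ⁻¹' {ξ} ⊆ Metric.ball ξ (t / 40) := fun x hx => by
      rw [Metric.mem_ball, ← Set.mem_singleton_iff.1 hx]
      linarith [hσt x]
    calc (m : ℝ) ^ q * |w ξ| ≤ m ^ q * (2 * μ.real (Metric.ball ξ (t / 40))) := by
          have := (hw ξ).trans (mul_le_mul_of_nonneg_left (measureReal_mono hsub) zero_le_two)
          gcongr
      _ = 2 * (m ^ q * μ.real (Metric.ball ξ (t / 40))) := by ring
      _ ≤ 2 * 1 := by
          have := measureReal_ball_mul_le hq hm hrot (r := t / 40) (by linarith) ξ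
          linarith
      _ = 2 := by norm_num
  · have h1 : #{ξ ∈ C | w ξ ≠ 0} ≤ #S := card_le_card fun ξ hξ => by
      by_contra hξS
      exact (mem_filter.1 hξ).2 (hw0 ξ hξS)
    have h2 := card_mul_pow_le_of_separated (S := S) (a := t / 200) (by positivity) (by linarith)
      fun x hx y hy hxy => by linarith [hsep x hx y hy hxy]
    have h3 : (t / 200) ^ q * ((200 * (q + 1) ^ 2) ^ q * (m : ℝ) ^ q) = 1 := by
      rw [← mul_pow, ← mul_pow, ht]
      field_simp
      norm_num
    calc ((#{ξ ∈ C | w ξ ≠ 0} : ℕ) : ℝ) ≤ #S := by exact_mod_cast h1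
      _ = #S * (t / 200) ^ q * ((200 * (q + 1) ^ 2) ^ q * (m : ℝ) ^ q) := by
          rw [mul_assoc, h3, mul_one]
      _ ≤ 2 * (q + 1) * 2 ^ (q + 1) * ((200 * (q + 1) ^ 2) ^ q * (m : ℝ) ^ q) := by gcongr
      _ = _ := by ring

end SD
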